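/- arXiv:1402.4169 — 4 statements merged into one kernel-verified Lean document; each statement's English description precedes it below -/
import Mathlib

section
/- Let S ⊆ V be nonempty. Then det Δ_Ŝ^Ŝ equals the sum of the weights of all spanning forests F of G with exactly |S| connected components such that each connected component of (V,F) contains exactly one vertex of S. (Equivalently: det Δ_Ŝ^Ŝ is the weighted number of acyclic edge sets F ⊆ E with |F| = |V| − |S| in which no two distinct vertices of S are joined by a path.) -/
open scoped Classical

/-- The weighted Laplacian of `w` on a finite vertex set. -/
noncomputable def lap {V : Type*} [Fintype V] [DecidableEq V] (w : V → V → ℝ) :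
    Matrix V V ℝ :=
  Matrix.of fun u v =>
    if u = v then ∑ x ∈ Finset.univ.filter (fun x => x ≠ u), w u x else -(w u v)

/-- The edge set `{v, f v}` spanned by a parent function `f` defined away from the roots `S`. -/
noncomputable def parentEdges {V : Type*} [Fintype V] {S : Finset V}
    (f : {x : V // x ∉ S} → V) : Finset (Sym2 V) :=
  Finset.univ.image fun v : {x : V // x ∉ S} => s((v : V), f v)

/-- A parent function is rooted when some height function strictly decreases along it. -/
def IsRooted {V : Type*} {S : Finset V} (f : {x : V // x ∉ S} → V) : Prop :=
  ∃ h : V → ℕ, ∀ v : {x : V // x ∉ S}, h (f v) < h v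

/-- The matrix `1 - P`, where `P` is the transition matrix of a parent function. -/
noncomputable def parentMatrix {V : Type*} {S : Finset V} (f : {x : V // x ∉ S} → V) :
    Matrix {x : V // x ∉ S} {x : V // x ∉ S} ℝ :=
  Matrix.of fun v x => (if v = x then 1 else 0) - (if f v = x then 1 else 0)

/-- Extension of a parent function by the identity on the roots. -/
noncomputable def parentStep {V : Type*} {S : Finset V} (f : {x : V // x ∉ S} → V) (x : V) : V :=
  if h : x ∉ S then f ⟨x, h⟩ else x

section ParentFunction

variable {V : Type*} {S : Finset V} {f : {x : V // x ∉ S} → V}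

lemma parentStep_of_mem {x : V} (hx : x ∈ S) : parentStep f x = x := by
  simp [parentStep, hx]

lemma parentStep_of_notMem {x : V} (hx : x ∉ S) : parentStep f x = f ⟨x, hx⟩ := by
  simp [parentStep, hx]

lemma parentStep_iterate_mem {h : V → ℕ} (hf : ∀ v : {x : V // x ∉ S}, h (f v) < h v) :
    ∀ (n : ℕ) (x : V), h x ≤ n → (parentStep f)^[n] x ∈ S := by
  intro n
  induction n with
  | zero =>
    intro x hx
    by_contra hxS
    have := hf ⟨x, hxS⟩
    simp only at this
    omega
  | succ n ih =>
    intro x hx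
    by_cases hxS : x ∈ S
    · rwa [Function.iterate_fixed (parentStep_of_mem hxS)]
    · rw [Function.iterate_succ_apply, parentStep_of_notMem hxS]
      apply ih
      have := hf ⟨x, hxS⟩
      simp only at this
      omega

lemma isRooted_of_forall_iterate_mem (H : ∀ x, ∃ n, (parentStep f)^[n] x ∈ S) : IsRooted f := by
  refine ⟨fun x => Nat.find (H x), fun v => ?_⟩
  obtain ⟨v, hv⟩ := v
  simp only
  rw [Nat.lt_find_iff]
  intro m hm
  by_contra hmem
  cases m with
  | zero => exact hv hmem
  | succ m =>
    rw [Function.iterate_succ_apply, parentStep_of_notMem hv] at hmem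
    exact absurd (Nat.find_min' (H (f ⟨v, hv⟩)) hmem) (by omega)

/-- A rooted parent function sends each vertex to a root, constantly along parent edges. -/
lemma IsRooted.exists_root [Finite V] (hf : IsRooted f) :
    ∃ r : V → V, (∀ s ∈ S, r s = s) ∧ ∀ v : {x : V // x ∉ S}, r (f v) = r v := by
  obtain ⟨h, hh⟩ := hf
  obtain ⟨N, hN⟩ := (Set.finite_range h).bddAbove
  refine ⟨(parentStep f)^[N], fun s hs => Function.iterate_fixed (parentStep_of_mem hs) N,
    fun v => ?_⟩
  rw [← parentStep_of_notMem (f := f) v.2, ← Function.iterate_succ_apply, Function.iterate_succ_apply']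
  exact parentStep_of_mem (parentStep_iterate_mem hh N v (hN ⟨v, rfl⟩))

lemma IsRooted.ne (hf : IsRooted f) (v : {x : V // x ∉ S}) : (v : V) ≠ f v := by
  obtain ⟨h, hh⟩ := hf
  intro hv
  have := hh v
  rw [← hv] at this
  exact lt_irrefl _ this

lemma IsRooted.parentEdge_injective (hf : IsRooted f) :
    Function.Injective fun v : {x : V // x ∉ S} => s((v : V), f v) := by
  obtain ⟨h, hh⟩ := hf
  intro u v huv
  rcases Sym2.eq_iff.1 huv with ⟨h1, -⟩ | ⟨h1, h2⟩
  · exact Subtype.ext h1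
  · have h3 := hh u
    have h4 := hh v
    rw [h2] at h3
    rw [← h1] at h4
    omega

variable [Fintype V]

lemma mem_parentEdges {e : Sym2 V} : e ∈ parentEdges f ↔ ∃ v : {x : V // x ∉ S}, s((v : V), f v) = e := by
  simp [parentEdges]

lemma IsRooted.card_parentEdges (hf : IsRooted f) :
    (parentEdges f).card = Fintype.card V - S.card := by
  rw [parentEdges, Finset.card_image_of_injective _ hf.parentEdge_injective, Finset.card_univ,
    Fintype.card_subtype_compl, Fintype.card_coe]

lemma IsRooted.prod_parentEdges (hf : IsRooted f) (c : Sym2 V → ℝ) :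
    ∏ e ∈ parentEdges f, c e = ∏ v : {x : V // x ∉ S}, c s((v : V), f v) := by
  rw [parentEdges, Finset.prod_image fun a _ b _ hab => hf.parentEdge_injective hab]

lemma IsRooted.isAcyclic (hf : IsRooted f) :
    (SimpleGraph.fromEdgeSet (parentEdges f : Set (Sym2 V))).IsAcyclic := by
  obtain ⟨h, hh⟩ := hf
  intro a c hc
  obtain ⟨u, hu, hmax⟩ := c.support.toFinset.exists_max_image h ⟨a, by simp⟩
  rw [List.mem_toFinset] at hu
  have hc' := hc.rotate hu
  have key : ∀ x ∈ (c.rotate u hu).support,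
      (SimpleGraph.fromEdgeSet (parentEdges f : Set (Sym2 V))).Adj u x →
      ∃ hu : u ∉ S, x = f ⟨u, hu⟩ := by
    intro x hx hadj
    rw [SimpleGraph.fromEdgeSet_adj, Finset.mem_coe, mem_parentEdges] at hadj
    obtain ⟨⟨v, hv⟩, -⟩ := hadj
    rcases Sym2.eq_iff.1 hv with ⟨rfl, h2⟩ | ⟨rfl, h2⟩
    · exact ⟨v.2, h2.symm⟩
    · have h3 := hmax v (by simpa using hx)
      have h4 := hh v
      rw [h2] at h4
      omega
  obtain ⟨h1, h2⟩ := key _ (SimpleGraph.Walk.getVert_mem_support _ _)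
    (SimpleGraph.Walk.adj_snd hc'.not_nil)
  obtain ⟨h3, h4⟩ := key _ (SimpleGraph.Walk.getVert_mem_support _ _)
    (SimpleGraph.Walk.adj_penultimate hc'.not_nil).symm
  exact hc'.snd_ne_penultimate (h2.trans h4.symm)

lemma IsRooted.not_reachable (hf : IsRooted f) {u v : V} (hu : u ∈ S) (hv : v ∈ S)
    (huv : u ≠ v) :
    ¬ (SimpleGraph.fromEdgeSet (parentEdges f : Set (Sym2 V))).Reachable u v := by
  obtain ⟨r, hrS, hr⟩ := hf.exists_root
  rintro ⟨p⟩
  have key : r u = r v := by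
    clear hu hv huv
    induction p with
    | nil => rfl
    | cons hadj _ ih =>
      rw [← ih]
      rw [SimpleGraph.fromEdgeSet_adj, Finset.mem_coe, mem_parentEdges] at hadj
      obtain ⟨⟨x, hx⟩, -⟩ := hadj
      rcases Sym2.eq_iff.1 hx with ⟨rfl, rfl⟩ | ⟨rfl, rfl⟩
      · exact (hr x).symm
      · exact hr x
  exact huv (by rwa [hrS u hu, hrS v hv] at key)

lemma IsRooted.exists_reachable (hf : IsRooted f) (v : V) :
    ∃ s ∈ S, (SimpleGraph.fromEdgeSet (parentEdges f : Set (Sym2 V))).Reachable v s := by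
  have hne := hf.ne
  obtain ⟨h, hh⟩ := hf
  induction hn : h v using Nat.strong_induction_on generalizing v with
  | _ n ih =>
    by_cases hv : v ∈ S
    · exact ⟨v, hv, .refl _⟩
    · obtain ⟨s, hs, hr⟩ := ih _ (hn ▸ hh ⟨v, hv⟩) _ rfl
      refine ⟨s, hs, SimpleGraph.Reachable.trans (SimpleGraph.Adj.reachable ?_) hr⟩
      rw [SimpleGraph.fromEdgeSet_adj]
      exact ⟨mem_parentEdges.2 ⟨⟨v, hv⟩, rfl⟩, hne ⟨v, hv⟩⟩

lemma IsRooted.eq_of_parentEdges_eq {g : {x : V // x ∉ S} → V} (hg : IsRooted g)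
    (hfg : parentEdges f = parentEdges g) : f = g := by
  obtain ⟨h, hh⟩ := hg
  funext v
  by_contra hv
  induction hn : h v using Nat.strong_induction_on generalizing v with
  | _ n ih =>
    have hmem : s((v : V), g v) ∈ parentEdges f := hfg ▸ mem_parentEdges.2 ⟨v, rfl⟩
    obtain ⟨u, hu⟩ := mem_parentEdges.1 hmem
    rcases Sym2.eq_iff.1 hu with ⟨h1, h2⟩ | ⟨h1, h2⟩
    · exact hv (Subtype.ext h1 ▸ h2)
    · have hlt : h u < h v := h1 ▸ hh v
      refine ih _ (hn ▸ hlt) u (fun h3 => ?_) rfl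
      have := hh u
      rw [← h3, h2] at this
      omega

/-- The determinant of `1 - P` is the indicator of being rooted. -/
lemma det_parentMatrix [DecidableEq V] (f : {x : V // x ∉ S} → V) :
    (parentMatrix f).det = if IsRooted f then 1 else 0 := by
  split_ifs with hf
  · obtain ⟨h, hh⟩ := hf
    have hM : (parentMatrix f).BlockTriangular
        (fun v : {x : V // x ∉ S} => OrderDual.toDual (h v)) := by
      intro i j hij
      have hij' : h i < h j := hij
      have h1 : i ≠ j := by rintro rfl; omega
      have h2 : f i ≠ j := by
        intro hc
        have := hh i
        rw [hc] at this
        omega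
      simp [parentMatrix, h1, h2]
    rw [hM.det]
    refine Finset.prod_eq_one fun a _ => ?_
    suffices h1 : (parentMatrix f).toSquareBlock
        (fun v : {x : V // x ∉ S} => OrderDual.toDual (h v)) a = 1 by
      rw [h1, Matrix.det_one]
    ext i j
    have h2 : f i ≠ j := by
      intro hc
      have h3 := hh i
      have h4 : h i = h j := i.2.trans j.2.symm
      rw [hc] at h3
      omega
    simp [parentMatrix, Matrix.toSquareBlock_def, h2, Matrix.one_apply, Subtype.ext_iff]
  · have hC : ∃ x, ∀ n, (parentStep f)^[n] x ∉ S := by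
      by_contra! hcon
      exact hf (isRooted_of_forall_iterate_mem hcon)
    obtain ⟨x, hx⟩ := hC
    rw [← Matrix.exists_mulVec_eq_zero_iff]
    refine ⟨fun y => if ∀ n, (parentStep f)^[n] (y : V) ∉ S then 1 else 0, fun h0 => ?_, ?_⟩
    · have := congrFun h0 ⟨x, hx 0⟩
      simp [hx] at this
    · ext v
      simp only [Matrix.mulVec, dotProduct, parentMatrix, Matrix.of_apply, sub_mul, ite_mul, one_mul,
        zero_mul, Finset.sum_sub_distrib, Finset.sum_ite_eq, Finset.mem_univ, if_true,
        Pi.zero_apply]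
      have hv : (∀ n, (parentStep f)^[n] (v : V) ∉ S) ↔ ∀ n, (parentStep f)^[n] (f v) ∉ S := by
        refine ⟨fun h n => ?_, fun h n => ?_⟩
        · simpa [parentStep_of_notMem v.2] using h (n + 1)
        · cases n with
          | zero => exact v.2
          | succ n => simpa [parentStep_of_notMem v.2] using h n
      by_cases hfv : f v ∈ S
      · have h1 : ∀ x : {x : V // x ∉ S}, f v ≠ x := fun x hx => x.2 (hx ▸ hfv)
        have h2 : ¬ ∀ n, (parentStep f)^[n] (f v) ∉ S := fun h => h 0 hfv
        simp [h1, hv, h2]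
      · have h1 : ∀ x : {x : V // x ∉ S}, f v = x ↔ ⟨f v, hfv⟩ = x := fun x => by
          rw [Subtype.ext_iff]
        simp [h1, hv]

end ParentFunction

/-- The first step of a geodesic decreases the distance to its target. -/
lemma SimpleGraph.Reachable.exists_adj_dist_lt {V : Type*} {G : SimpleGraph V} {v t : V}
    (hvt : G.Reachable v t) (hne : v ≠ t) : ∃ u, G.Adj v u ∧ G.dist u t < G.dist v t := by
  obtain ⟨p, hp⟩ := hvt.exists_walk_length_eq_dist
  cases p with
  | nil => exact (hne rfl).elim
  | cons hadj q =>
    rw [← hp]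
    exact ⟨_, hadj, (SimpleGraph.dist_le q).trans_lt (by simp)⟩

/-- An acyclic edge set with `|V| - |S|` edges that separates `S` comes from a rooted parent
function. -/
lemma exists_isRooted_parentEdges_eq {V : Type*} [Fintype V] [DecidableEq V] {S : Finset V}
    {F : Finset (Sym2 V)} (hdiag : ∀ e ∈ F, ¬ e.IsDiag)
    (hF : (SimpleGraph.fromEdgeSet (F : Set (Sym2 V))).IsAcyclic)
    (hcard : F.card = Fintype.card V - S.card)
    (hsep : ∀ u ∈ S, ∀ v ∈ S, u ≠ v →
      ¬ (SimpleGraph.fromEdgeSet (F : Set (Sym2 V))).Reachable u v) :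
    ∃ f : {x : V // x ∉ S} → V, IsRooted f ∧ parentEdges f = F := by
  set G := SimpleGraph.fromEdgeSet (F : Set (Sym2 V)) with hG
  obtain ⟨T, hT, hmax⟩ := (Finset.univ.filter fun T : Finset V => S ⊆ T ∧
    ∀ u ∈ T, ∀ v ∈ T, u ≠ v → ¬ G.Reachable u v).exists_max_image Finset.card
    ⟨S, by simpa using hsep⟩
  simp only [Finset.mem_filter, Finset.mem_univ, true_and] at hT hmax
  obtain ⟨hST, hTsep⟩ := hT
  have hreach : ∀ v, ∃ t ∈ T, G.Reachable v t := by
    intro v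
    by_contra! hcon
    have hv : v ∉ T := fun hv => hcon v hv (.refl _)
    have := hmax (insert v T) ⟨hST.trans (Finset.subset_insert _ _), ?_⟩
    · rw [Finset.card_insert_of_notMem hv] at this
      omega
    · intro a ha b hb hab
      rcases Finset.mem_insert.1 ha with hav | haT <;>
        rcases Finset.mem_insert.1 hb with hbv | hbT
      · exact (hab (hav.trans hbv.symm)).elim
      · exact hav ▸ hcon b hbT
      · exact fun h => hcon a haT (hbv ▸ h.symm)
      · exact hTsep a haT b hbT hab
  choose r hrT hr using hreach
  have hparent : ∀ v : {x : V // x ∉ T}, ∃ u, G.Adj v u ∧ G.dist u (r u) < G.dist v (r v) := by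
    rintro ⟨v, hv⟩
    obtain ⟨u, hadj, hlt⟩ := (hr v).exists_adj_dist_lt fun h => hv (h ▸ hrT v)
    have hru : r u = r v := by
      by_contra hne
      exact hTsep _ (hrT u) _ (hrT v) hne
        ((hr u).symm.trans (hadj.reachable.symm.trans (hr v)))
    exact ⟨u, hadj, hru ▸ hlt⟩
  choose f hadj hlt using hparent
  have hf : IsRooted f := ⟨fun v => G.dist v (r v), hlt⟩
  have hsub : parentEdges f ⊆ F := by
    intro e he
    obtain ⟨v, rfl⟩ := mem_parentEdges.1 he
    exact ((SimpleGraph.fromEdgeSet_adj _).1 (hadj v)).1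
  have heq : parentEdges f = F := by
    refine hsub.antisymm fun e he => ?_
    by_contra hnot
    induction e with
    | _ a b =>
    have hab : a ≠ b := fun h => hdiag _ he h
    have hGab : G.Adj a b := (SimpleGraph.fromEdgeSet_adj _).2 ⟨he, hab⟩
    have hbridge := SimpleGraph.isAcyclic_iff_forall_adj_isBridge.1 hF hGab
    rw [SimpleGraph.isBridge_iff] at hbridge
    obtain ⟨s, hs, has⟩ := hf.exists_reachable a
    obtain ⟨t, ht, hbt⟩ := hf.exists_reachable b
    have hle : SimpleGraph.fromEdgeSet (parentEdges f : Set (Sym2 V)) ≤ G :=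
      SimpleGraph.fromEdgeSet_mono (by exact_mod_cast hsub)
    have hst : s = t := by
      by_contra hne
      exact hTsep s hs t ht hne
        ((has.mono hle).symm.trans (hGab.reachable.trans (hbt.mono hle)))
    subst hst
    refine hbridge ((has.trans hbt.symm).mono ?_)
    intro x y hxy
    rw [SimpleGraph.fromEdgeSet_adj] at hxy
    simp only [SimpleGraph.deleteEdges_adj, Set.mem_singleton_iff]
    refine ⟨(SimpleGraph.fromEdgeSet_adj _).2 ⟨hsub hxy.1, hxy.2⟩, fun h => hnot ?_⟩
    exact h ▸ hxy.1
  have hcardT : Fintype.card V - T.card = Fintype.card V - S.card := by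
    rw [← hcard, ← heq, hf.card_parentEdges]
  have hTS : T.card ≤ S.card := by
    have := T.card_le_univ
    have := S.card_le_univ
    omega
  obtain rfl := Finset.eq_of_subset_of_card_le hST hTS
  exact ⟨f, hf, heq⟩

/-- Expansion of the reduced Laplacian determinant over parent functions. -/
lemma det_lap_submatrix {V : Type*} [Fintype V] [DecidableEq V] (w : V → V → ℝ) (S : Finset V) :
    ((lap w).submatrix (Subtype.val : {x : V // x ∉ S} → V) Subtype.val).det
      = ∑ f : {x : V // x ∉ S} → V, (∏ v : {x : V // x ∉ S}, w v (f v)) * (parentMatrix f).det := by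
  have hrow : (lap w).submatrix (Subtype.val : {x : V // x ∉ S} → V) Subtype.val =
      fun v : {x : V // x ∉ S} => ∑ x : V, w v x • fun y : {x : V // x ∉ S} =>
        ((if v = y then 1 else 0) - (if x = y then 1 else 0) : ℝ) := by
    ext v y
    simp only [Matrix.submatrix_apply, lap, Matrix.of_apply, Finset.sum_apply, Pi.smul_apply,
      smul_eq_mul, mul_sub, mul_ite, mul_one, mul_zero, Finset.sum_sub_distrib,
      Finset.sum_ite_eq', Finset.mem_univ, if_true]
    by_cases hvy : v = y
    · subst hvy
      simp [Finset.filter_ne', Finset.sum_erase_eq_sub]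
    · simp [hvy, Subtype.coe_inj]
  rw [hrow]
  change Matrix.detRowAlternating.toMultilinearMap _ = _
  rw [MultilinearMap.map_sum]
  refine Finset.sum_congr rfl fun f _ => ?_
  rw [MultilinearMap.map_smul_univ, smul_eq_mul]
  congr 1
  change Matrix.det _ = _
  congr 1
  ext v y
  simp only [parentMatrix, Matrix.of_apply]
  congr!

/-- **All-minors Matrix-Tree Theorem.**  Let `w` be symmetric nonnegative weights with
zero diagonal on a finite vertex set `V`, and let `G` be the graph whose edges are the
pairs of positive weight; assume `G` is connected.  For a nonempty `S ⊆ V`, the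
determinant of the Laplacian with the rows and columns of `S` deleted equals the
weighted number of acyclic edge sets `F ⊆ E` with `|F| = |V| - |S|` in which no two
distinct vertices of `S` are joined by a path. -/
theorem stmt_1 {V : Type*} [Fintype V] [DecidableEq V]
    (hV : 1 < Fintype.card V)
    (w : V → V → ℝ) (hsym : ∀ u v, w u v = w v u)
    (hw : ∀ u v, 0 ≤ w u v) (hw0 : ∀ v, w v v = 0)
    (G : SimpleGraph V) (hG : ∀ u v, G.Adj u v ↔ u ≠ v ∧ 0 < w u v)
    (hconn : G.Connected)
    (S : Finset V) (hS : S.Nonempty) :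
    ((lap w).submatrix (Subtype.val : {x : V // x ∉ S} → V) Subtype.val).det
    = ∑ F ∈ Finset.univ.filter (fun F : Finset (Sym2 V) =>
          (F : Set (Sym2 V)) ⊆ G.edgeSet ∧
          (SimpleGraph.fromEdgeSet (F : Set (Sym2 V))).IsAcyclic ∧
          F.card = Fintype.card V - S.card ∧
          ∀ u ∈ S, ∀ v ∈ S, u ≠ v →
            ¬ (SimpleGraph.fromEdgeSet (F : Set (Sym2 V))).Reachable u v),
        ∏ e ∈ F, Sym2.lift ⟨w, hsym⟩ e := by
  rw [det_lap_submatrix]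
  simp only [det_parentMatrix, mul_ite, mul_one, mul_zero]
  rw [← Finset.sum_filter, ← Finset.sum_filter_ne_zero]
  have hpos : ∀ f ∈ ((Finset.univ.filter fun f : {x : V // x ∉ S} → V => IsRooted f).filter
      fun f => ∏ v : {x : V // x ∉ S}, w v (f v) ≠ 0), IsRooted f ∧ ∀ v : {x : V // x ∉ S}, w v (f v) ≠ 0 := by
    intro f hf
    simpa [Finset.prod_ne_zero_iff] using hf
  refine Finset.sum_nbij parentEdges ?_ ?_ ?_ ?_
  · intro f hf
    obtain ⟨hroot, hne⟩ := hpos f hf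
    simp only [Finset.mem_filter, Finset.mem_univ, true_and]
    refine ⟨?_, hroot.isAcyclic, hroot.card_parentEdges,
      fun u hu v hv huv => hroot.not_reachable hu hv huv⟩
    intro e he
    obtain ⟨v, rfl⟩ := mem_parentEdges.1 he
    exact (hG _ _).2 ⟨hroot.ne v, lt_of_le_of_ne (hw _ _) (hne v).symm⟩
  · intro f hf g hg hfg
    exact (hpos g hg).1.eq_of_parentEdges_eq hfg
  · intro F hF
    simp only [Finset.coe_filter, Finset.mem_univ, true_and, Set.mem_ofPred_eq] at hF
    obtain ⟨hFG, hac, hcard, hsep⟩ := hF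
    obtain ⟨f, hroot, rfl⟩ := exists_isRooted_parentEdges_eq
      (fun e he => G.not_isDiag_of_mem_edgeSet (hFG he)) hac hcard hsep
    refine ⟨f, ?_, rfl⟩
    simp only [Finset.coe_filter, Finset.mem_filter, Finset.mem_univ, true_and, Set.mem_ofPred_eq,
      Finset.prod_ne_zero_iff]
    refine ⟨hroot, fun v _ => ?_⟩
    exact ((hG _ _).1 (hFG (mem_parentEdges.2 ⟨v, rfl⟩))).2.ne'
  · intro f hf
    rw [(hpos f hf).1.prod_parentEdges]
    simp only [Sym2.lift_mk]
    congr!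
end

section
/- For any vertex s ∈ V, the weighted number of two-component spanning forests satisfies F₂(G) = Σ_{v ∈ V, v ≠ s} det Δ_{v̂,ŝ}^{v̂,ŝ} − Σ_{{u,v} ∈ E with u,v ≠ s} w(u,v) · det Δ_{û,v̂,ŝ}^{û,v̂,ŝ}, where the second sum is over unordered edges {u,v} of G avoiding s. -/
open scoped Classical

/-- The determinant of the Laplacian with the rows and columns indexed by `S` deleted. -/
noncomputable def lapMinorDet {V : Type*} [Fintype V] [DecidableEq V]
    (w : V → V → ℝ) (S : Finset V) : ℝ :=
  ((lap w).submatrix (Subtype.val : {x : V // x ∉ S} → V) Subtype.val).det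

/-- The weighted sum `F_k(G)` of `k`-component spanning forests of `G`:
subsets `F` of the edge set which are acyclic and whose spanning subgraph has exactly
`k` connected components, weighted by the product of `w` over their edges. -/
noncomputable def forestSum {V : Type*} [Fintype V] [DecidableEq V]
    (w : V → V → ℝ) (hsym : ∀ u v, w u v = w v u) (G : SimpleGraph V) (k : ℕ) : ℝ :=
  ∑ F ∈ Finset.univ.filter (fun F : Finset (Sym2 V) =>
      (F : Set (Sym2 V)) ⊆ G.edgeSet ∧
      (SimpleGraph.fromEdgeSet (F : Set (Sym2 V))).IsAcyclic ∧
      Nat.card (SimpleGraph.fromEdgeSet (F : Set (Sym2 V))).ConnectedComponent = k),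
    ∏ e ∈ F, Sym2.lift ⟨w, hsym⟩ e


section RootedForests

open Finset Matrix SimpleGraph

variable {V : Type*}

/-- `x` is joined to some element of `S` by a path with edges in `F`. -/
def ReachableFrom (F : Finset (Sym2 V)) (S : Finset V) (x : V) : Prop :=
  ∃ r ∈ S, (fromEdgeSet (F : Set (Sym2 V))).Reachable r x

/-- Every vertex is joined to some element of `S` by a path with edges in `F`. -/
def SpansFrom (F : Finset (Sym2 V)) (S : Finset V) : Prop :=
  ∀ x, ReachableFrom F S x

theorem ReachableFrom.of_mem {F : Finset (Sym2 V)} {S : Finset V} {x : V} (hx : x ∈ S) :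
    ReachableFrom F S x :=
  ⟨x, hx, .rfl⟩

theorem ReachableFrom.step {F : Finset (Sym2 V)} {S : Finset V} {x y : V}
    (hx : ReachableFrom F S x) (hxy : s(x, y) ∈ F) : ReachableFrom F S y := by
  obtain ⟨r, hr, hrx⟩ := hx
  by_cases h : x = y
  · exact h ▸ ⟨r, hr, hrx⟩
  · exact ⟨r, hr, hrx.trans (Adj.reachable (by simp [hxy, h]))⟩

theorem ReachableFrom.induction {F : Finset (Sym2 V)} {S : Finset V} {P : V → Prop}
    (hS : ∀ x ∈ S, P x) (hF : ∀ x y, s(x, y) ∈ F → P x → P y) {x : V}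
    (hx : ReachableFrom F S x) : P x := by
  obtain ⟨r, hr, hrx⟩ := hx
  rw [reachable_iff_reflTransGen] at hrx
  induction hrx with
  | refl => exact hS r hr
  | tail _ h ih => exact hF _ _ (by simpa using (fromEdgeSet_adj _).1 h |>.1) ih

theorem reachableFrom_singleton {F : Finset (Sym2 V)} {r x : V} :
    ReachableFrom F {r} x ↔ (fromEdgeSet (F : Set (Sym2 V))).Reachable r x := by
  simp [ReachableFrom]

theorem ReachableFrom.mono {F F' : Finset (Sym2 V)} {S S' : Finset V} {x : V}
    (hF : F ⊆ F') (hS : S ⊆ S') (hx : ReachableFrom F S x) : ReachableFrom F' S' x :=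
  hx.induction (fun _ h => .of_mem (hS h)) fun _ _ h hx => hx.step (hF h)

theorem edgeSet_fromEdgeSet_of_forall_not_isDiag {F : Finset (Sym2 V)} (hF : ∀ e ∈ F, ¬ e.IsDiag) :
    (fromEdgeSet (F : Set (Sym2 V))).edgeSet = F := by
  rw [edgeSet_fromEdgeSet, sdiff_eq_left, Set.disjoint_left]
  exact fun e he => by simpa using hF e he

variable [DecidableEq V]

theorem SpansFrom.of_insert {F : Finset (Sym2 V)} {S : Finset V} {a b : V}
    (h : SpansFrom (insert s(a, b) F) S) (ha : ReachableFrom F S a) :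
    SpansFrom F (insert b S) := fun x => by
  refine (h x).induction (fun x hx => .of_mem (mem_insert_of_mem hx)) fun x y hxy hx => ?_
  rcases mem_insert.1 hxy with hxy | hxy
  · rcases Sym2.eq_iff.1 hxy with ⟨rfl, rfl⟩ | ⟨rfl, rfl⟩
    · exact .of_mem (mem_insert_self _ _)
    · exact ha.mono subset_rfl (subset_insert _ _)
  · exact hx.step hxy

theorem spansFrom_insert_edge_iff {F : Finset (Sym2 V)} {S : Finset V} {r u : V} (hr : r ∈ S) :
    SpansFrom (insert s(r, u) F) S ↔ SpansFrom F (insert u S) := by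
  refine ⟨fun h => h.of_insert (.of_mem hr), fun h x => ?_⟩
  refine (h x).induction (fun x hx => ?_) fun x y hxy hx => hx.step (mem_insert_of_mem hxy)
  rcases mem_insert.1 hx with rfl | hx
  · exact ReachableFrom.step (.of_mem hr) (mem_insert_self _ _)
  · exact .of_mem hx

variable [Fintype V]

theorem SpansFrom.card_le {F : Finset (Sym2 V)} {S : Finset V} (h : SpansFrom F S) :
    Fintype.card V ≤ #F + #S := by
  induction F using Finset.induction_on generalizing S with
  | empty =>
    have : S = univ := eq_univ_of_forall fun x =>
      (h x).induction (P := (· ∈ S)) (fun _ => id) (by simp)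
    simp [this]
  | insert e F he ih =>
    induction e with | _ a b
    rw [card_insert_of_notMem he]
    by_cases ha : ReachableFrom F S a
    · have := ih (h.of_insert ha)
      have := card_insert_le b S
      omega
    by_cases hb : ReachableFrom F S b
    · rw [Sym2.eq_swap] at h
      have := ih (h.of_insert hb)
      have := card_insert_le a S
      omega
    have : SpansFrom F S := fun x => by
      refine (h x).induction (fun x hx => .of_mem hx) fun x y hxy hx => ?_
      rcases mem_insert.1 hxy with hxy | hxy
      · rcases Sym2.eq_iff.1 hxy with ⟨rfl, rfl⟩ | ⟨rfl, rfl⟩ <;> contradiction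
      · exact hx.step hxy
    have := ih this
    omega

/-- `F` is a spanning forest each of whose components contains exactly one element of `S`,
expressed through the number of edges. -/
def IsRootedForest (F : Finset (Sym2 V)) (S : Finset V) : Prop :=
  #F + #S = Fintype.card V ∧ SpansFrom F S

theorem IsRootedForest.not_spansFrom_of_card_lt {F F' : Finset (Sym2 V)} {S S' : Finset V}
    (h : IsRootedForest F S) (hlt : #F' + #S' < #F + #S) : ¬ SpansFrom F' S' := fun h' => by
  have := h'.card_le
  have := h.1
  omega

theorem IsRootedForest.not_reachable {F : Finset (Sym2 V)} {S : Finset V} {r t : V}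
    (h : IsRootedForest F S) (hr : r ∈ S) (ht : t ∈ S) (hrt : r ≠ t) :
    ¬ (fromEdgeSet (F : Set (Sym2 V))).Reachable r t := fun hreach => by
  refine h.not_spansFrom_of_card_lt (F' := F) (S' := S.erase t) ?_ fun x => ?_
  · have := card_erase_lt_of_mem ht
    omega
  refine (h.2 x).induction (fun x hx => ?_) fun x y hxy hx => hx.step hxy
  by_cases hxt : x = t
  · exact ⟨r, mem_erase.2 ⟨hrt, hr⟩, hxt ▸ hreach⟩
  · exact .of_mem (mem_erase.2 ⟨hxt, hx⟩)

theorem IsRootedForest.notMem_of_mem {F : Finset (Sym2 V)} {S : Finset V} {r t : V}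
    (h : IsRootedForest F S) (hr : r ∈ S) (ht : t ∈ S) : s(r, t) ∉ F := fun hrt => by
  refine h.not_spansFrom_of_card_lt (F' := F.erase s(r, t)) (S' := S) ?_ fun x => ?_
  · have := card_erase_lt_of_mem hrt
    omega
  refine (h.2 x).induction (fun x hx => .of_mem hx) fun x y hxy hx => ?_
  by_cases he : s(x, y) = s(r, t)
  · rcases Sym2.eq_iff.1 he with ⟨rfl, rfl⟩ | ⟨rfl, rfl⟩
    · exact .of_mem ht
    · exact .of_mem hr
  · exact hx.step (mem_erase.2 ⟨he, hxy⟩)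

theorem IsRootedForest.not_isDiag {F : Finset (Sym2 V)} {S : Finset V}
    (h : IsRootedForest F S) {e : Sym2 V} (he : e ∈ F) : ¬ e.IsDiag := fun hd => by
  induction e with | _ a b
  obtain rfl : a = b := by simpa using hd
  refine h.not_spansFrom_of_card_lt (F' := F.erase s(a, a)) (S' := S) ?_ fun x => ?_
  · have := card_erase_lt_of_mem he
    omega
  refine (h.2 x).induction (fun x hx => .of_mem hx) fun x y hxy hx => ?_
  by_cases hxy' : s(x, y) = s(a, a)
  · obtain ⟨rfl, rfl⟩ : x = a ∧ y = a := by simpa using hxy'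
    exact hx
  · exact hx.step (mem_erase.2 ⟨hxy', hxy⟩)

theorem isRootedForest_insert_edge_iff {F : Finset (Sym2 V)} {S : Finset V} {r u : V}
    (hr : r ∈ S) (hu : u ∉ S) (he : s(r, u) ∉ F) :
    IsRootedForest (insert s(r, u) F) S ↔ IsRootedForest F (insert u S) := by
  rw [IsRootedForest, IsRootedForest, spansFrom_insert_edge_iff hr, card_insert_of_notMem he,
    card_insert_of_notMem hu, add_right_comm, add_assoc]

variable {R : Type*} [CommRing R]

/-- The weighted sum of the spanning forests rooted at `S`. -/
noncomputable def rootedForestSum (c : Sym2 V → R) (S : Finset V) : R :=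
  ∑ F : Finset (Sym2 V) with IsRootedForest F S, ∏ e ∈ F, c e

theorem sum_mem_isRootedForest (c : Sym2 V → R) {S : Finset V} {r u : V}
    (hr : r ∈ S) (hu : u ∉ S) :
    ∑ F : Finset (Sym2 V) with IsRootedForest F S ∧ s(r, u) ∈ F, ∏ e ∈ F, c e =
      c s(r, u) * rootedForestSum c (insert u S) := by
  rw [rootedForestSum, mul_sum]
  have hmem {F : Finset (Sym2 V)} (hF : IsRootedForest F (insert u S)) : s(r, u) ∉ F :=
    hF.notMem_of_mem (mem_insert_of_mem hr) (mem_insert_self _ _)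
  refine sum_bij' (fun F _ => F.erase s(r, u)) (fun F _ => insert s(r, u) F) ?_ ?_ ?_ ?_ ?_
  · simp only [mem_filter, mem_univ, true_and]
    rintro F ⟨hF, he⟩
    rwa [← isRootedForest_insert_edge_iff hr hu (notMem_erase _ _), insert_erase he]
  · simp only [mem_filter, mem_univ, true_and]
    exact fun F hF =>
      ⟨(isRootedForest_insert_edge_iff hr hu (hmem hF)).2 hF, mem_insert_self _ _⟩
  · exact fun F hF => insert_erase (mem_filter.1 hF).2.2
  · exact fun F hF => erase_insert (hmem (mem_filter.1 hF).2)
  · exact fun F hF => (mul_prod_erase F c (mem_filter.1 hF).2.2).symm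

theorem rootedForestSum_eq_update_add (c : Sym2 V → R) {S : Finset V} {r u : V}
    (hr : r ∈ S) (hu : u ∉ S) :
    rootedForestSum c S = rootedForestSum (Function.update c s(r, u) 0) S +
      c s(r, u) * rootedForestSum c (insert u S) := by
  rw [← sum_mem_isRootedForest c hr hu, rootedForestSum, rootedForestSum,
    ← filter_filter (fun F => IsRootedForest F S) (fun F => s(r, u) ∈ F),
    ← sum_filter_not_add_sum_filter _ (fun F => s(r, u) ∈ F)]
  congr 1
  rw [sum_filter]
  refine sum_congr rfl fun F _ => ?_
  by_cases he : s(r, u) ∈ F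
  · rw [if_neg (not_not.2 he), prod_eq_zero he (Function.update_self _ _ _)]
  · rw [if_pos he]
    refine prod_congr rfl fun e h => (Function.update_of_ne ?_ _ _).symm
    rintro rfl
    exact he h

/-- The Laplacian of the edge weight `c`, with the rows indexed by `S` replaced by those of the
identity matrix. -/
noncomputable def groundedLaplacian (c : Sym2 V → R) (S : Finset V) : Matrix V V R :=
  of fun u v => if u ∈ S then (if u = v then 1 else 0) else
    if u = v then ∑ x with x ≠ u, c s(u, x) else -c s(u, v)

theorem groundedLaplacian_of_mem (c : Sym2 V → R) {S : Finset V} {u : V} (hu : u ∈ S) :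
    groundedLaplacian c S u = Pi.single u 1 := by
  ext v
  simp [groundedLaplacian, hu, Pi.single_apply, eq_comm]

theorem det_groundedLaplacian_eq_update_add (c : Sym2 V → R) {S : Finset V} {r u : V}
    (hr : r ∈ S) (hu : u ∉ S) :
    (groundedLaplacian c S).det = (groundedLaplacian (Function.update c s(r, u) 0) S).det +
      c s(r, u) * (groundedLaplacian c (insert u S)).det := by
  have hru : r ≠ u := by rintro rfl; exact hu hr
  set A := groundedLaplacian (Function.update c s(r, u) 0) S with hA
  have hne {i j : V} (hi : i ∉ S) (hiu : i ≠ u) : s(i, j) ≠ s(r, u) := by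
    have : i ≠ r := by rintro rfl; exact hi hr
    simp [hiu, this]
  have hself : groundedLaplacian c S =
      A.updateRow u (A u + c s(r, u) • (Pi.single u 1 + (-1 : R) • Pi.single r 1)) := by
    ext i j
    by_cases hiu : i = u
    · subst hiu
      rw [updateRow_self]
      by_cases hij : i = j
      · subst hij
        have hri : r ∈ univ.filter (· ≠ i) := by simp [hru]
        simp only [hA, groundedLaplacian, of_apply, hu, if_false, if_true, Pi.add_apply,
          Pi.smul_apply, Pi.single_eq_same, smul_eq_mul, Pi.single_eq_of_ne hru.symm]
        rw [← add_sum_erase _ _ hri, ← add_sum_erase _ _ hri, Sym2.eq_swap (a := i) (b := r)]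
        rw [Function.update_self, sum_congr rfl fun x hx => (Function.update_of_ne
          (show s(i, x) ≠ s(r, i) by
            have := (mem_erase.1 hx).1
            simp [this, hru.symm]) 0 c).symm]
        ring
      · by_cases hjr : j = r
        · subst hjr
          simp [hA, groundedLaplacian, hu, hru, hij, Sym2.eq_swap (a := i)]
        · have : s(i, j) ≠ s(r, i) := by simp [hjr, hru.symm]
          simp [hA, groundedLaplacian, hu, hij, hjr, this, Ne.symm hij]
    · rw [updateRow_ne hiu]
      by_cases hi : i ∈ S
      · simp [hA, groundedLaplacian, hi]
      · simp [hA, groundedLaplacian, hi, Function.update_of_ne (hne hi hiu)]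
  have hins : groundedLaplacian c (insert u S) = A.updateRow u (Pi.single u 1) := by
    ext i j
    by_cases hiu : i = u
    · subst hiu
      rw [updateRow_self, groundedLaplacian_of_mem c (mem_insert_self _ _)]
    · rw [updateRow_ne hiu]
      by_cases hi : i ∈ S
      · simp [hA, groundedLaplacian, hi]
      · simp [hA, groundedLaplacian, hi, hiu, Function.update_of_ne (hne hi hiu)]
  have hzero : (A.updateRow u (Pi.single r 1)).det = 0 :=
    det_zero_of_row_eq hru (by
      rw [updateRow_ne hru, updateRow_self, hA, groundedLaplacian_of_mem _ hr])
  rw [hself, det_updateRow_add, det_updateRow_smul, det_updateRow_add, det_updateRow_smul,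
    hzero, updateRow_eq_self, hins, mul_zero, add_zero]

theorem det_groundedLaplacian [IsDomain R] (c : Sym2 V → R) (S : Finset V) :
    (groundedLaplacian c S).det = rootedForestSum c S := by
  induction hn : #Sᶜ + #{e | c e ≠ 0} using Nat.strong_induction_on generalizing c S with
  | _ n ih =>
  subst hn
  by_cases hcut : ∃ r ∈ S, ∃ u ∉ S, c s(r, u) ≠ 0
  · obtain ⟨r, hr, u, hu, hc⟩ := hcut
    rw [det_groundedLaplacian_eq_update_add c hr hu, rootedForestSum_eq_update_add c hr hu,
      ih _ _ _ _ rfl, ih _ _ _ _ rfl]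
    · gcongr
      exact compl_ssubset_compl.2 (ssubset_insert hu)
    · gcongr
      refine ssubset_iff_of_subset ?_ |>.2 ⟨s(r, u), by simp [hc]⟩
      intro e he
      by_cases h : e = s(r, u) <;> simp_all
  push Not at hcut
  by_cases hS : S = univ
  · subst hS
    have : groundedLaplacian c univ = 1 := by
      ext i j
      simp [groundedLaplacian, one_apply]
    rw [this, det_one, rootedForestSum, sum_eq_single ∅]
    · simp
    · intro F hF hne
      have := (mem_filter.1 hF).2.1
      simp_all
    · intro h
      refine absurd ?_ h
      simp only [mem_filter, mem_univ, true_and]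
      exact ⟨by simp, fun x => .of_mem (mem_univ x)⟩
  obtain ⟨v, hv⟩ : ∃ v, v ∉ S := by
    by_contra! h
    exact hS (eq_univ_of_forall h)
  have hdet : (groundedLaplacian c S).det = 0 := by
    refine exists_mulVec_eq_zero_iff.1 ⟨fun x => if x ∈ S then 0 else 1, fun h => ?_, ?_⟩
    · simpa [hv] using congrFun h v
    ext u
    by_cases hu : u ∈ S
    · simp [mulVec, groundedLaplacian_of_mem c hu, hu]
    · rw [mulVec, dotProduct, ← add_sum_erase _ _ (mem_univ u)]
      simp only [groundedLaplacian, of_apply, hu, if_false, if_true, mul_one, Pi.zero_apply]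
      rw [filter_ne', ← sum_add_distrib]
      refine sum_eq_zero fun x hx => ?_
      have hxu := (mem_erase.1 hx).1
      by_cases hxS : x ∈ S
      · simp [hxS, Sym2.eq_swap (a := u), hcut x hxS u hu]
      · simp [hxS, hxu.symm]
  rw [hdet, rootedForestSum, sum_eq_zero]
  intro F hF
  by_contra hprod
  refine hv (((mem_filter.1 hF).2.2 v).induction (P := (· ∈ S)) (fun _ => id) ?_)
  intro x y hxy hx
  by_contra hy
  exact hprod (prod_eq_zero hxy (hcut x hx y hy))

theorem isTree_iff_isRootedForest {W : Type*} [Fintype W] {F : Finset (Sym2 W)}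
    (hF : ∀ e ∈ F, ¬ e.IsDiag) (s : W) :
    (fromEdgeSet (F : Set (Sym2 W))).IsTree ↔ IsRootedForest F {s} := by
  rw [isTree_iff_connected_and_card, edgeSet_fromEdgeSet_of_forall_not_isDiag hF, and_comm,
    IsRootedForest, connected_iff_exists_forall_reachable]
  simp only [SpansFrom, reachableFrom_singleton, card_singleton]
  simp only [SetLike.coe_sort_coe, Nat.card_eq_fintype_card, Fintype.card_coe]
  exact and_congr_right fun _ => ⟨fun ⟨r, hr⟩ x => (hr s).symm.trans (hr x), fun h => ⟨s, h⟩⟩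

theorem isAcyclic_and_card_connectedComponent_eq_two_iff {F : Finset (Sym2 V)}
    (hF : ∀ e ∈ F, ¬ e.IsDiag) (s : V) :
    (fromEdgeSet (F : Set (Sym2 V))).IsAcyclic ∧
      Nat.card (fromEdgeSet (F : Set (Sym2 V))).ConnectedComponent = 2 ↔
    ∃ t ≠ s, IsRootedForest F {t, s} := by
  have hins {t : V} (hts : t ≠ s) : ∀ e ∈ insert s(s, t) F, ¬ e.IsDiag := by
    intro e he
    rcases mem_insert.1 he with rfl | he
    · simpa using hts.symm
    · exact hF e he
  have hsup (t : V) : fromEdgeSet ((insert s(s, t) F : Finset (Sym2 V)) : Set (Sym2 V)) =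
      fromEdgeSet (F : Set (Sym2 V)) ⊔ fromEdgeSet {s(s, t)} := by
    rw [coe_insert, Set.insert_eq, Set.union_comm, fromEdgeSet_union]
  constructor
  · rintro ⟨hac, hcard⟩
    obtain ⟨x, y, hxy, huniv⟩ := Nat.card_eq_two_iff.1 hcard
    obtain ⟨t, hst, ht⟩ : ∃ t, ¬ (fromEdgeSet (F : Set (Sym2 V))).Reachable s t ∧
        ∀ z, (fromEdgeSet (F : Set (Sym2 V))).Reachable t z ∨
          (fromEdgeSet (F : Set (Sym2 V))).Reachable s z := by
      have hmem (z : V) : connectedComponentMk _ z = x ∨ connectedComponentMk _ z = y := by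
        have : connectedComponentMk _ z ∈ ({x, y} : Set _) := huniv ▸ Set.mem_univ _
        simpa using this
      induction x using ConnectedComponent.ind with | _ x
      induction y using ConnectedComponent.ind with | _ y
      simp only [ConnectedComponent.eq, ne_eq] at hmem hxy
      rcases hmem s with h | h
      · exact ⟨y, fun h' => hxy (h.symm.trans h'), fun z =>
          (hmem z).symm.imp .symm fun hz => h.trans hz.symm⟩
      · exact ⟨x, fun h' => hxy (h'.symm.trans h), fun z =>
          (hmem z).imp .symm fun hz => h.trans hz.symm⟩
    have hts : t ≠ s := by rintro rfl; exact hst .rfl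
    have hnot : s(s, t) ∉ F := fun h => hst (Adj.reachable (by simp [h, hts.symm]))
    refine ⟨t, hts, ?_⟩
    rw [← isRootedForest_insert_edge_iff (mem_singleton_self s) (by simpa using hts) hnot,
      ← isTree_iff_isRootedForest (hins hts)]
    refine ⟨(connected_iff_exists_forall_reachable _).2 ⟨s, ?_⟩, ?_⟩
    · have : SpansFrom (insert s(s, t) F) {s} :=
        (spansFrom_insert_edge_iff (mem_singleton_self s)).2 fun z => by
          simpa [ReachableFrom] using ht z
      exact fun z => reachableFrom_singleton.1 (this z)
    · rw [hsup]
      exact (isAcyclic_add_edge_iff_of_not_reachable s t hst).2 hac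
  · rintro ⟨t, hts, h⟩
    have hnot : s(s, t) ∉ F := h.notMem_of_mem (by simp) (by simp)
    have htree := (isTree_iff_isRootedForest (hins hts) s).2
      ((isRootedForest_insert_edge_iff (mem_singleton_self s) (by simpa using hts) hnot).2 h)
    refine ⟨htree.isAcyclic.anti ?_, ?_⟩
    · rw [hsup]
      exact le_sup_left
    rw [Nat.card_eq_two_iff]
    refine ⟨connectedComponentMk _ t, connectedComponentMk _ s, ?_, ?_⟩
    · rw [ne_eq, ConnectedComponent.eq]
      exact h.not_reachable (by simp) (by simp) hts
    · refine Set.eq_univ_of_forall fun z => ?_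
      induction z using ConnectedComponent.ind with | _ z
      obtain ⟨r, hr, hrz⟩ := h.2 z
      rcases mem_insert.1 hr with rfl | hr
      · exact .inl (ConnectedComponent.eq.2 hrz.symm)
      · exact .inr (ConnectedComponent.eq.2 (mem_singleton.1 hr ▸ hrz.symm))

theorem IsRootedForest.pair_iff_not_reachable {F : Finset (Sym2 V)} {s t v : V} (hts : t ≠ s)
    (h : IsRootedForest F {t, s}) :
    v ≠ s ∧ IsRootedForest F {v, s} ↔ ¬ (fromEdgeSet (F : Set (Sym2 V))).Reachable s v := by
  refine ⟨fun hv => hv.2.not_reachable (by simp) (by simp) hv.1.symm, fun hv => ?_⟩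
  have hvs : v ≠ s := by rintro rfl; exact hv .rfl
  refine ⟨hvs, by rw [← h.1, card_pair hvs, card_pair hts], fun x => ?_⟩
  have key (z : V) : (fromEdgeSet (F : Set (Sym2 V))).Reachable t z ∨
      (fromEdgeSet (F : Set (Sym2 V))).Reachable s z := by
    simpa [ReachableFrom] using h.2 z
  have htv := (key v).resolve_right hv
  rcases key x with hx | hx
  · exact ⟨v, by simp, htv.symm.trans hx⟩
  · exact ⟨s, by simp, hx⟩

theorem two_mul_card_eq_card_pairs {F : Finset (Sym2 V)} (hF : ∀ e ∈ F, ¬ e.IsDiag) :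
    2 * #F = #{p : V × V | s(p.1, p.2) ∈ F} := by
  have hedge (inst : Fintype (fromEdgeSet (F : Set (Sym2 V))).edgeSet) :
      (fromEdgeSet (F : Set (Sym2 V))).edgeFinset = F := by
    rw [← coe_inj, coe_edgeFinset]
    exact edgeSet_fromEdgeSet_of_forall_not_isDiag hF
  have htwo := two_mul_card_edgeFinset (fromEdgeSet (F : Set (Sym2 V)))
  rw [hedge] at htwo
  rw [htwo]
  congr 1
  ext ⟨u, v⟩
  simp only [mem_filter, mem_univ, true_and, fromEdgeSet_adj, mem_coe, and_iff_left_iff_imp]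
  rintro huv rfl
  exact hF _ huv (Sym2.mk_isDiag_iff.2 rfl)

/-- In a forest with two components, the component avoiding `s` has one vertex more than it has
edges; the edges are counted as ordered pairs. -/
theorem IsRootedForest.card_pairs_add_two {F : Finset (Sym2 V)} {s t : V} (hts : t ≠ s)
    (h : IsRootedForest F {t, s}) :
    #{p : V × V | (p.1 ≠ s ∧ p.2 ≠ s ∧ p.1 ≠ p.2) ∧ IsRootedForest F {p.2, s} ∧
      s(p.2, p.1) ∈ F} + 2 = 2 * #{v | v ≠ s ∧ IsRootedForest F {v, s}} := by
  set C : Finset V := {v | v ≠ s ∧ IsRootedForest F {v, s}} with hC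
  have hmemC {v : V} : v ∈ C ↔ ¬ (fromEdgeSet (F : Set (Sym2 V))).Reachable s v := by
    rw [hC, mem_filter, ← h.pair_iff_not_reachable hts]
    simp
  have hCstep {x y : V} (hxy : s(x, y) ∈ F) : x ∈ C ↔ y ∈ C := by
    rw [hmemC, hmemC, ← reachableFrom_singleton, ← reachableFrom_singleton, not_iff_not]
    exact ⟨fun hx => hx.step hxy, fun hy => hy.step (Sym2.eq_swap ▸ hxy)⟩
  have hsC : s ∉ C := by simp [hC]
  have htC : t ∈ C := by simp [hC, hts, h]
  set FC : Finset (Sym2 V) := {e ∈ F | ∀ x ∈ e, x ∈ C}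
  set FD : Finset (Sym2 V) := {e ∈ F | ¬ ∀ x ∈ e, x ∈ C}
  have hcard : #FC + #FD = #F := card_filter_add_card_filter_not _
  have hspanC : SpansFrom FC (insert t Cᶜ) := fun z => by
    refine (h.2 z).induction (fun x hx => ?_) fun x y hxy hx => ?_
    · refine .of_mem ?_
      rcases mem_insert.1 hx with rfl | hx
      · exact mem_insert_self _ _
      · rw [mem_singleton.1 hx]
        exact mem_insert_of_mem (mem_compl.2 hsC)
    · by_cases hy : y ∈ C
      · exact hx.step (mem_filter.2 ⟨hxy, by simp [hy, (hCstep hxy).2 hy]⟩)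
      · exact .of_mem (mem_insert_of_mem (mem_compl.2 hy))
  have hspanD : SpansFrom FD (insert s C) := fun z => by
    refine (h.2 z).induction (fun x hx => ?_) fun x y hxy hx => ?_
    · refine .of_mem ?_
      rcases mem_insert.1 hx with rfl | hx
      · exact mem_insert_of_mem htC
      · rw [mem_singleton.1 hx]
        exact mem_insert_self _ _
    · by_cases hy : y ∈ C
      · exact .of_mem (mem_insert_of_mem hy)
      · exact hx.step (mem_filter.2 ⟨hxy, by simp [hy]⟩)
  have hle := hspanC.card_le
  have hle' := hspanD.card_le
  rw [card_insert_of_notMem (by simpa using htC), card_compl] at hle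
  rw [card_insert_of_notMem hsC] at hle'
  have hF := h.1
  rw [card_pair hts] at hF
  have hCle := card_le_univ C
  have hpairs : 2 * #FC = #{p : V × V | (p.1 ≠ s ∧ p.2 ≠ s ∧ p.1 ≠ p.2) ∧
      IsRootedForest F {p.2, s} ∧ s(p.2, p.1) ∈ F} := by
    rw [two_mul_card_eq_card_pairs fun e he => h.not_isDiag (mem_filter.1 he).1]
    congr 1
    ext ⟨u, v⟩
    simp only [mem_filter, mem_univ, true_and, Sym2.ball]
    constructor
    · rintro ⟨huv, hu, hv⟩
      have hne : u ≠ v := by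
        rintro rfl
        exact h.not_isDiag huv (Sym2.mk_isDiag_iff.2 rfl)
      have hu' := (mem_filter.1 hu).2
      have hv' := (mem_filter.1 hv).2
      exact ⟨⟨hu'.1, hv'.1, hne⟩, hv'.2, Sym2.eq_swap ▸ huv⟩
    · rintro ⟨⟨_, hvs, _⟩, hv, hvu⟩
      have hvC : v ∈ C := by simp [hC, hvs, hv]
      exact ⟨Sym2.eq_swap ▸ hvu, (hCstep hvu).1 hvC, hvC⟩
  omega

theorem lapMinorDet_eq_rootedForestSum (w : V → V → ℝ) (hsym : ∀ u v, w u v = w v u)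
    (S : Finset V) : lapMinorDet w S = rootedForestSum (Sym2.lift ⟨w, hsym⟩) S := by
  rw [← det_groundedLaplacian, twoBlockTriangular_det _ (· ∉ S)]
  · have h : toSquareBlockProp (groundedLaplacian (Sym2.lift ⟨w, hsym⟩) S) (fun i => ¬ i ∉ S) =
        1 := by
      ext i j
      simp [toSquareBlockProp, groundedLaplacian, not_not.1 i.2, one_apply, Subtype.ext_iff]
    rw [h, det_one, mul_one, lapMinorDet]
    congr 1
    ext i j
    simp [toSquareBlockProp, groundedLaplacian, lap, i.2]
  · intro i hi j hj
    rw [groundedLaplacian_of_mem _ (not_not.1 hi), Pi.single_eq_of_ne]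
    rintro rfl
    exact hi hj

end RootedForests

/-- **Two-component spanning forest formula** (Liu–Chow / Myrvold):
`F₂(G) = Σ_{v ≠ s} det Δ_{v̂,ŝ}^{v̂,ŝ} − Σ_{{u,v} ∈ E, u,v ≠ s} w(u,v) det Δ_{û,v̂,ŝ}^{û,v̂,ŝ}`,
where the second sum over unordered edges avoiding `s` is written as half of the sum
over ordered pairs. -/
theorem stmt_2 {V : Type*} [Fintype V] [DecidableEq V]
    (hV : 1 < Fintype.card V)
    (w : V → V → ℝ) (hsym : ∀ u v, w u v = w v u)
    (hw : ∀ u v, 0 ≤ w u v) (hw0 : ∀ v, w v v = 0)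
    (G : SimpleGraph V) (hG : ∀ u v, G.Adj u v ↔ u ≠ v ∧ 0 < w u v)
    (hconn : G.Connected) (s : V) :
    forestSum w hsym G 2
      = (∑ v ∈ Finset.univ.filter (fun v => v ≠ s), lapMinorDet w {v, s})
        - (1/2) * ∑ u : V, ∑ v : V,
            (if G.Adj u v ∧ u ≠ s ∧ v ≠ s
              then w u v * lapMinorDet w {u, v, s} else 0) := by
  set c : Sym2 V → ℝ := Sym2.lift ⟨w, hsym⟩ with hc
  have hsingle : ∑ v with v ≠ s, lapMinorDet w {v, s} = ∑ F : Finset (Sym2 V),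
      (Finset.card {v | v ≠ s ∧ IsRootedForest F {v, s}} : ℝ) * ∏ e ∈ F, c e := by
    simp_rw [lapMinorDet_eq_rootedForestSum w hsym, rootedForestSum]
    simp_rw [Finset.sum_filter fun F => IsRootedForest F _]
    rw [Finset.sum_comm]
    refine Finset.sum_congr rfl fun F _ => ?_
    rw [← Finset.sum_filter, Finset.filter_filter, Finset.sum_const, nsmul_eq_mul]
  have hpair : ∑ u : V, ∑ v : V, (if G.Adj u v ∧ u ≠ s ∧ v ≠ s
        then w u v * lapMinorDet w {u, v, s} else 0) = ∑ F : Finset (Sym2 V),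
      (Finset.card {p : V × V | (p.1 ≠ s ∧ p.2 ≠ s ∧ p.1 ≠ p.2) ∧ IsRootedForest F {p.2, s} ∧
        s(p.2, p.1) ∈ F} : ℝ) * ∏ e ∈ F, c e := by
    have hterm (u v : V) : (if G.Adj u v ∧ u ≠ s ∧ v ≠ s
        then w u v * lapMinorDet w {u, v, s} else 0) = ∑ F : Finset (Sym2 V),
        if (u ≠ s ∧ v ≠ s ∧ u ≠ v) ∧ IsRootedForest F {v, s} ∧ s(v, u) ∈ F
          then ∏ e ∈ F, c e else 0 := by
      by_cases h : u ≠ s ∧ v ≠ s ∧ u ≠ v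
      · have hforest := sum_mem_isRootedForest c (S := {v, s}) (r := v) (u := u)
          (by simp) (by simp [h.1, h.2.2])
        refine Eq.trans ?_
          (Finset.sum_congr rfl fun F _ => if_congr (and_iff_right h) rfl rfl).symm
        rw [← Finset.sum_filter, hforest, ← lapMinorDet_eq_rootedForestSum w hsym, hc,
          Sym2.lift_mk, show (⟨w, hsym⟩ : {f : V → V → ℝ // ∀ a b, f a b = f b a}).1 v u = w u v
            from hsym v u]
        by_cases huv : G.Adj u v
        · simp [huv, h]
        · have : w u v = 0 := by
            by_contra hne
            exact huv ((hG u v).2 ⟨h.2.2, (hw u v).lt_of_ne' hne⟩)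
          simp [huv, this]
      · have : ¬ (G.Adj u v ∧ u ≠ s ∧ v ≠ s) := fun h' => h ⟨h'.2.1, h'.2.2, h'.1.ne⟩
        simp [h, this]
    simp_rw [hterm]
    rw [← Fintype.sum_prod_type', Finset.sum_comm]
    refine Finset.sum_congr rfl fun F _ => ?_
    rw [← Finset.sum_filter, Finset.sum_const, nsmul_eq_mul]
  rw [hsingle, hpair, Finset.mul_sum, ← Finset.sum_sub_distrib, forestSum, Finset.sum_filter]
  refine Finset.sum_congr rfl fun F _ => ?_
  by_cases hprod : ∏ e ∈ F, c e = 0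
  · rw [hprod, mul_zero, mul_zero, mul_zero, sub_zero, ite_self]
  have hFG : (F : Set (Sym2 V)) ⊆ G.edgeSet := fun e he => by
    have hne := Finset.prod_ne_zero_iff.1 hprod e he
    induction e with | _ u v
    rw [hc, Sym2.lift_mk] at hne
    refine (hG u v).2 ⟨?_, (hw u v).lt_of_ne' hne⟩
    rintro rfl
    exact hne (hw0 u)
  have hdiag : ∀ e ∈ F, ¬ e.IsDiag := fun e he => G.not_isDiag_of_mem_edgeSet (hFG he)
  have hiff := isAcyclic_and_card_connectedComponent_eq_two_iff hdiag s
  by_cases h : ∃ t ≠ s, IsRootedForest F {t, s}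
  · rw [if_pos ⟨hFG, hiff.2 h⟩]
    obtain ⟨t, hts, ht⟩ := h
    have hcount : (_ : ℝ) = _ := congrArg Nat.cast (ht.card_pairs_add_two hts)
    push_cast at hcount
    linear_combination ((1 / 2) * ∏ e ∈ F, c e) * hcount
  · rw [if_neg fun h' => h (hiff.1 h'.2)]
    push Not at h
    rw [Finset.filter_false_of_mem fun v _ hv => h v hv.1 hv.2,
      Finset.filter_false_of_mem fun p _ hp => h p.2 hp.1.2.1 hp.2.1]
    simp
end

section
/- For any vertex s ∈ V, F₂(G) = F₁(G) · Σ_{{u,v} ∈ E} w(u,v) · [ (A^{(s)}_{u,v} − A^{(s)}_{v,u})² + A^{(s)}_{u,v} · A^{(s)}_{v,u} ], where the sum is over unordered edges {u,v} of G. -/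
open scoped Classical

/-- The Green's function with Dirichlet boundary condition at `s`:
`G^{(s)}_{u,v} = ((Δ_ŝ^ŝ)⁻¹)_{u,v}` for `u, v ≠ s`, and `0` if `u = s` or `v = s`. -/
noncomputable def green {V : Type*} [Fintype V] [DecidableEq V]
    (w : V → V → ℝ) (s u v : V) : ℝ :=
  if hu : u = s then 0
  else if hv : v = s then 0
  else (((lap w).submatrix (Subtype.val : {x : V // x ≠ s} → V) Subtype.val)⁻¹)
      (⟨u, hu⟩ : {x : V // x ≠ s}) (⟨v, hv⟩ : {x : V // x ≠ s})

/-- The potential kernel `A^{(s)}_{u,v} = G^{(s)}_{u,u} - G^{(s)}_{u,v}`. -/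
noncomputable def pker {V : Type*} [Fintype V] [DecidableEq V]
    (w : V → V → ℝ) (s u v : V) : ℝ :=
  green w s u u - green w s u v

namespace RootedForest

variable {V : Type*}

/-- `f` sends every vertex outside `R` one step closer to `R` and fixes `R` pointwise. -/
def IsParentMap (R : Finset V) (f : V → V) : Prop :=
  (∀ r ∈ R, f r = r) ∧ ∃ ρ : V → ℕ, ∀ u ∉ R, ρ (f u) < ρ u

/-- `H` is a spanning forest each of whose components contains exactly one vertex of `R`. -/
def IsRooted (R : Finset V) (H : SimpleGraph V) : Prop :=
  H.IsAcyclic ∧ (∀ u, ∃ r ∈ R, H.Reachable u r) ∧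
    ∀ r ∈ R, ∀ r' ∈ R, H.Reachable r r' → r = r'

theorem mem_of_reachable {H : SimpleGraph V} {S : Set V}
    (hS : ∀ u v, H.Adj u v → u ∈ S → v ∈ S) {u v : V} (h : H.Reachable u v) (hu : u ∈ S) :
    v ∈ S := by
  obtain ⟨p⟩ := h
  induction p with
  | nil => exact hu
  | cons hadj _ ih => exact ih (hS _ _ hadj hu)

theorem IsParentMap.ne {R : Finset V} {f : V → V} (hf : IsParentMap R f) {u : V} (hu : u ∉ R) :
    f u ≠ u := by
  obtain ⟨-, ρ, hρ⟩ := hf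
  intro h
  have := hρ u hu
  rw [h] at this
  exact lt_irrefl _ this

theorem IsParentMap.not_swap {R : Finset V} {f : V → V} (hf : IsParentMap R f) {u v : V}
    (hu : u ∉ R) (hv : v ∉ R) (huv : f u = v) : f v ≠ u := by
  obtain ⟨-, ρ, hρ⟩ := hf
  intro h
  have h1 := hρ u hu
  have h2 := hρ v hv
  rw [huv] at h1
  rw [h] at h2
  omega

theorem mem_descendants_of_adj {R : Finset V} {f : V → V} {u x y : V}
    (hxy : (x ∉ R ∧ f x = y) ∨ (y ∉ R ∧ f y = x)) (hne : x ∉ R → f x = y → x ≠ u)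
    (hx : ∃ k, f^[k] x = u) : ∃ k, f^[k] y = u := by
  obtain ⟨k, hk⟩ := hx
  rcases hxy with ⟨h, rfl⟩ | ⟨h, rfl⟩
  · cases k with
    | zero => exact absurd hk (hne h rfl)
    | succ k => exact ⟨k, hk⟩
  · exact ⟨k + 1, hk⟩

theorem IsRooted.card_connectedComponent {R : Finset V} {H : SimpleGraph V} (h : IsRooted R H) :
    Nat.card H.ConnectedComponent = R.card := by
  rw [← Fintype.card_coe R, ← Nat.card_eq_fintype_card]
  symm
  refine Nat.card_congr (Equiv.ofBijective
    (fun r : R => H.connectedComponentMk r) ⟨?_, ?_⟩)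
  · rintro ⟨r, hr⟩ ⟨r', hr'⟩ hrr'
    exact Subtype.ext (h.2.2 r hr r' hr' (SimpleGraph.ConnectedComponent.eq.1 hrr'))
  · intro c
    induction c using SimpleGraph.ConnectedComponent.ind with
    | _ v =>
      obtain ⟨r, hr, hvr⟩ := h.2.1 v
      exact ⟨⟨r, hr⟩, SimpleGraph.ConnectedComponent.eq.2 hvr.symm⟩

theorem isParentMap_of_reaches {R : Finset V} {f : V → V} (hfix : ∀ r ∈ R, f r = r)
    (h : ∀ v, ∃ k, f^[k] v ∈ R) : IsParentMap R f := by
  refine ⟨hfix, fun v => Nat.find (h v), fun u hu => ?_⟩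
  change Nat.find (h (f u)) < Nat.find (h u)
  have hspec := Nat.find_spec (h u)
  rcases hk : Nat.find (h u) with _ | k
  · rw [hk] at hspec
    exact absurd hspec hu
  · rw [hk] at hspec
    exact Nat.lt_succ_of_le (Nat.find_min' (h (f u)) hspec)

theorem isRooted_singleton_iff {H : SimpleGraph V} (s : V) :
    IsRooted {s} H ↔ H.IsAcyclic ∧ Nat.card H.ConnectedComponent = 1 := by
  refine ⟨fun h => ⟨h.1, by simpa using h.card_connectedComponent⟩, ?_⟩
  rintro ⟨hac, hcard⟩
  have := (Nat.card_eq_one_iff_unique.1 hcard).1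
  refine ⟨hac, fun u => ⟨s, by simp, SimpleGraph.ConnectedComponent.eq.1 (Subsingleton.elim _ _)⟩,
    ?_⟩
  intro r hr r' hr' _
  rw [Finset.mem_singleton.1 hr, Finset.mem_singleton.1 hr']

theorem isRooted_pair_iff {H : SimpleGraph V} [DecidableEq V] {s x : V} (hx : x ≠ s) :
    IsRooted {s, x} H ↔
      (H.IsAcyclic ∧ Nat.card H.ConnectedComponent = 2) ∧ ¬ H.Reachable s x := by
  constructor
  · intro h
    refine ⟨⟨h.1, by rw [h.card_connectedComponent, Finset.card_pair hx.symm]⟩, fun hr => ?_⟩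
    exact hx (h.2.2 s (by simp) x (by simp) hr).symm
  · rintro ⟨⟨hac, hcard⟩, hsx⟩
    have hne : H.connectedComponentMk s ≠ H.connectedComponentMk x :=
      fun h => hsx (SimpleGraph.ConnectedComponent.eq.1 h)
    refine ⟨hac, fun u => ?_, ?_⟩
    · have huniv := (Nat.card_eq_two_iff' (H.connectedComponentMk s)).1 hcard
      by_cases hu : H.connectedComponentMk u = H.connectedComponentMk s
      · exact ⟨s, by simp, SimpleGraph.ConnectedComponent.eq.1 hu⟩
      · exact ⟨x, by simp, SimpleGraph.ConnectedComponent.eq.1 (huniv.unique hu hne.symm)⟩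
    · intro r hr r' hr' hrr'
      simp only [Finset.mem_insert, Finset.mem_singleton] at hr hr'
      rcases hr with rfl | rfl <;> rcases hr' with rfl | rfl
      · rfl
      · exact absurd hrr' hsx
      · exact absurd hrr'.symm hsx
      · rfl

variable [Fintype V] [DecidableEq V]

/-- The edges joining the vertices outside `R` to their parents. -/
def parentEdges (R : Finset V) (f : V → V) : Finset (Sym2 V) :=
  Rᶜ.image fun u => s(u, f u)

theorem mem_parentEdges {R : Finset V} {f : V → V} {u v : V} :
    s(u, v) ∈ parentEdges R f ↔ (u ∉ R ∧ f u = v) ∨ (v ∉ R ∧ f v = u) := by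
  simp only [parentEdges, Finset.mem_image, Finset.mem_compl, Sym2.eq_iff]
  constructor
  · rintro ⟨x, hx, ⟨rfl, rfl⟩ | ⟨rfl, rfl⟩⟩
    · exact Or.inl ⟨hx, rfl⟩
    · exact Or.inr ⟨hx, rfl⟩
  · rintro (⟨hu, rfl⟩ | ⟨hv, rfl⟩)
    · exact ⟨u, hu, Or.inl ⟨rfl, rfl⟩⟩
    · exact ⟨v, hv, Or.inr ⟨rfl, rfl⟩⟩

theorem IsParentMap.adj_iff {R : Finset V} {f : V → V} (hf : IsParentMap R f) {u v : V} :
    (SimpleGraph.fromEdgeSet (parentEdges R f : Set (Sym2 V))).Adj u v ↔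
      (u ∉ R ∧ f u = v) ∨ (v ∉ R ∧ f v = u) := by
  rw [SimpleGraph.fromEdgeSet_adj, Finset.mem_coe, mem_parentEdges, and_iff_left_iff_imp]
  rintro (⟨hu, rfl⟩ | ⟨hv, rfl⟩)
  · exact (hf.ne hu).symm
  · exact hf.ne hv

theorem IsParentMap.injOn {R : Finset V} {f : V → V} (hf : IsParentMap R f) :
    Set.InjOn (fun u => s(u, f u)) (Rᶜ : Finset V) := by
  intro u hu v hv h
  rw [Finset.mem_coe, Finset.mem_compl] at hu hv
  rcases Sym2.eq_iff.1 h with ⟨h, -⟩ | ⟨h1, h2⟩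
  · exact h
  · exact absurd h1.symm (hf.not_swap hu hv h2)

theorem IsParentMap.isRooted {R : Finset V} {f : V → V} (hf : IsParentMap R f) :
    IsRooted R (SimpleGraph.fromEdgeSet (parentEdges R f : Set (Sym2 V))) := by
  obtain ⟨hfix, ρ, hρ⟩ := id hf
  refine ⟨?_, ?_, ?_⟩
  · rw [SimpleGraph.isAcyclic_iff_forall_adj_isBridge]
    suffices H : ∀ u ∉ R, ¬ ((SimpleGraph.fromEdgeSet (parentEdges R f : Set (Sym2 V))).deleteEdges
        {s(u, f u)}).Reachable u (f u) by
      intro u v huv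
      rw [SimpleGraph.isBridge_iff]
      rcases hf.adj_iff.1 huv with ⟨hu, rfl⟩ | ⟨hv, rfl⟩
      · exact H u hu
      · rw [Sym2.eq_swap, SimpleGraph.reachable_comm]
        exact H v hv
    intro u hu hreach
    have hmem : f u ∈ {x | ∃ k, f^[k] x = u} := by
      refine mem_of_reachable ?_ hreach ⟨0, rfl⟩
      intro x y hxy hx
      rw [SimpleGraph.deleteEdges_adj, hf.adj_iff] at hxy
      refine mem_descendants_of_adj hxy.1 ?_ hx
      rintro - rfl rfl
      exact hxy.2 rfl
    obtain ⟨k, hk⟩ := hmem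
    have hle : ∀ k x, ρ (f^[k] x) ≤ ρ x := by
      intro k
      induction k with
      | zero => intro x; exact le_rfl
      | succ k ih =>
        intro x
        rw [Function.iterate_succ_apply]
        refine (ih _).trans ?_
        by_cases hx : x ∈ R
        · rw [hfix x hx]
        · exact (hρ x hx).le
    have h1 := hle k (f u)
    rw [hk] at h1
    exact absurd (hρ u hu) (not_lt.2 h1)
  · intro u
    induction h : ρ u using Nat.strong_induction_on generalizing u with
    | _ n ih =>
      by_cases hu : u ∈ R
      · exact ⟨u, hu, SimpleGraph.Reachable.refl _⟩
      · obtain ⟨r, hr, hreach⟩ := ih _ (h ▸ hρ u hu) (f u) rfl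
        exact ⟨r, hr, (hf.adj_iff.2 (Or.inl ⟨hu, rfl⟩)).reachable.trans hreach⟩
  · intro r hr r' hr' hreach
    have hmem : r' ∈ {x | ∃ k, f^[k] x = r} := by
      refine mem_of_reachable ?_ hreach ⟨0, rfl⟩
      intro x y hxy hx
      refine mem_descendants_of_adj (hf.adj_iff.1 hxy) ?_ hx
      rintro h - rfl
      exact h hr
    obtain ⟨k, hk⟩ := hmem
    rw [Function.iterate_fixed (hfix r' hr')] at hk
    exact hk.symm

theorem IsParentMap.eq_of_parentEdges_eq {R : Finset V} {f g : V → V} (hf : IsParentMap R f)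
    (hg : IsParentMap R g) (h : parentEdges R f = parentEdges R g) : f = g := by
  obtain ⟨hfix, ρ, hρ⟩ := id hf
  funext u
  induction hn : ρ u using Nat.strong_induction_on generalizing u with
  | _ n ih =>
    by_cases hu : u ∈ R
    · rw [hfix u hu, hg.1 u hu]
    · have h1 : s(u, f u) ∈ parentEdges R g := h ▸ mem_parentEdges.2 (Or.inl ⟨hu, rfl⟩)
      rcases mem_parentEdges.1 h1 with ⟨-, h2⟩ | ⟨h2, h3⟩
      · exact h2.symm
      · have h4 := ih _ (hn ▸ hρ u hu) (f u) rfl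
        exact absurd (h4.trans h3) (hf.not_swap hu h2 rfl)

theorem exists_parentMap {R : Finset V} {F : Finset (Sym2 V)} (hF : ∀ e ∈ F, ¬ e.IsDiag)
    (h : IsRooted R (SimpleGraph.fromEdgeSet (F : Set (Sym2 V)))) :
    ∃ f, IsParentMap R f ∧ parentEdges R f = F := by
  set H := SimpleGraph.fromEdgeSet (F : Set (Sym2 V)) with hH
  obtain ⟨hac, hex, huniq⟩ := h
  choose root hroot hreach using hex
  have hroot_adj : ∀ {u v}, H.Adj u v → root u = root v := fun {u v} huv =>
    huniq _ (hroot u) _ (hroot v)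
      (((hreach u).symm.trans huv.reachable).trans (hreach v))
  have hroot_self : ∀ r ∈ R, root r = r := fun r hr =>
    (huniq r hr _ (hroot r) (hreach r)).symm
  have hstep : ∀ u, ∃ v, (u ∈ R → v = u) ∧
      (u ∉ R → H.Adj u v ∧ H.dist v (root v) < H.dist u (root u)) := by
    intro u
    by_cases hu : u ∈ R
    · exact ⟨u, fun _ => rfl, fun h => absurd hu h⟩
    · obtain ⟨p, hp⟩ := (hreach u).exists_walk_length_eq_dist
      have hr := hroot u
      generalize hroot_u : root u = r at p hp hr
      cases p with
      | nil => exact absurd hr hu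
      | @cons _ v _ huv q =>
        refine ⟨v, fun h => absurd h hu, fun _ => ⟨huv, ?_⟩⟩
        rw [← hroot_adj huv, hroot_u, ← hp, SimpleGraph.Walk.length_cons]
        exact Nat.lt_succ_of_le (SimpleGraph.dist_le q)
  choose f hf1 hf2 using hstep
  have hf : IsParentMap R f := ⟨hf1, fun u => H.dist u (root u), fun u hu => (hf2 u hu).2⟩
  have hsub : parentEdges R f ⊆ F := by
    intro e he
    obtain ⟨u, hu, rfl⟩ := Finset.mem_image.1 he
    exact ((SimpleGraph.fromEdgeSet_adj _).1 (hf2 u (Finset.mem_compl.1 hu)).1).1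
  refine ⟨f, hf, hsub.antisymm ?_⟩
  intro e he
  by_contra hne
  induction e using Sym2.ind with
  | _ u v =>
    have huv : H.Adj u v := (SimpleGraph.fromEdgeSet_adj _).2 ⟨he, fun h => hF _ he h⟩
    refine SimpleGraph.isBridge_iff.1 (SimpleGraph.isAcyclic_iff_forall_adj_isBridge.1 hac huv) ?_
    obtain ⟨-, hex', -⟩ := hf.isRooted
    obtain ⟨a, ha, hua⟩ := hex' u
    obtain ⟨b, hb, hvb⟩ := hex' v
    have hle : SimpleGraph.fromEdgeSet (parentEdges R f : Set (Sym2 V)) ≤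
        H.deleteEdges {s(u, v)} := by
      intro x y hxy
      rw [SimpleGraph.fromEdgeSet_adj] at hxy
      rw [SimpleGraph.deleteEdges_adj, hH, SimpleGraph.fromEdgeSet_adj]
      refine ⟨⟨hsub hxy.1, hxy.2⟩, ?_⟩
      intro hmem
      rw [Set.mem_singleton_iff] at hmem
      exact hne (hmem ▸ hxy.1)
    have hle' := hle.trans (SimpleGraph.deleteEdges_le _)
    have hab : a = b := huniq a ha b hb
      (((hua.mono hle').symm.trans huv.reachable).trans (hvb.mono hle'))
    subst hab
    exact (hua.trans hvb.symm).mono hle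

/-- The Laplacian with every row indexed by `R` replaced by the corresponding row of the identity
matrix. -/
noncomputable def groundedLap (w : V → V → ℝ) (R : Finset V) : Matrix V V ℝ :=
  Matrix.of fun u => if u ∈ R then Pi.single u 1 else lap w u

/-- The weighted sum of the parent maps with root set `R`. -/
noncomputable def parentSum (w : V → V → ℝ) (R : Finset V) : ℝ :=
  ∑ f : V → V with IsParentMap R f, ∏ u ∈ Rᶜ, w u (f u)

/-- The reduced incidence matrix of the functional graph of `f`. -/
noncomputable def mapMatrix (R : Finset V) (f : V → V) : Matrix V V ℝ :=
  Matrix.of fun u => Pi.single u 1 - if u ∈ R then 0 else Pi.single (f u) 1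

theorem det_mapMatrix_of_isParentMap {R : Finset V} {f : V → V} (hf : IsParentMap R f) :
    (mapMatrix R f).det = 1 := by
  obtain ⟨-, ρ, hρ⟩ := hf
  have hentry : ∀ u v, ρ u ≤ ρ v → mapMatrix R f u v = (1 : Matrix V V ℝ) u v := by
    intro u v huv
    by_cases hu : u ∈ R
    · simp [mapMatrix, hu, Matrix.one_apply, Pi.single_apply, eq_comm]
    · have hne : v ≠ f u := by
        rintro rfl
        exact absurd (hρ u hu) (not_lt.2 huv)
      simp [mapMatrix, hu, Matrix.one_apply, Pi.single_apply, eq_comm (a := u), hne]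
  have htri : (Matrix.transpose (mapMatrix R f)).BlockTriangular ρ := by
    intro i j hij
    rw [Matrix.transpose_apply, hentry j i hij.le, Matrix.one_apply_ne]
    rintro rfl
    exact lt_irrefl _ hij
  rw [← Matrix.det_transpose, htri.det]
  refine Finset.prod_eq_one fun a _ => ?_
  have hblock : (mapMatrix R f).transpose.toSquareBlock ρ a = 1 := by
    ext ⟨i, hi⟩ ⟨j, hj⟩
    rw [Matrix.toSquareBlock_def, Matrix.of_apply, Matrix.transpose_apply,
      hentry j i (by rw [hi, hj])]
    simp [Matrix.one_apply, eq_comm]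
  rw [hblock, Matrix.det_one]

theorem det_mapMatrix_of_not_isParentMap {R : Finset V} {f : V → V} (hfix : ∀ r ∈ R, f r = r)
    (hf : ¬ IsParentMap R f) : (mapMatrix R f).det = 0 := by
  obtain ⟨v, hv⟩ : ∃ v, ∀ k, f^[k] v ∉ R := by
    by_contra! h
    exact hf (isParentMap_of_reaches hfix h)
  rw [← Matrix.exists_mulVec_eq_zero_iff]
  refine ⟨fun u => if ∀ k, f^[k] u ∉ R then 1 else 0, fun h => ?_, ?_⟩
  · simpa [hv] using congrFun h v
  · ext u
    by_cases hu : u ∈ R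
    · have : ¬ ∀ k, f^[k] u ∉ R := fun h => h 0 hu
      simp [mapMatrix, hu, Matrix.mulVec, this]
    · have : (∀ k, f^[k] u ∉ R) ↔ ∀ k, f^[k] (f u) ∉ R := by
        refine ⟨fun h k => h (k + 1), fun h k => ?_⟩
        cases k with
        | zero => exact hu
        | succ k => exact h k
      simp only [mapMatrix, hu, Matrix.mulVec, Matrix.of_apply, if_false, sub_dotProduct,
        single_dotProduct, one_mul, Pi.zero_apply, this, sub_self]

theorem det_groundedLap (w : V → V → ℝ) (R : Finset V) :
    (groundedLap w R).det = parentSum w R := by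
  have hrow : groundedLap w R = fun u => ∑ x,
      (if u ∈ R then if x = u then 1 else 0 else w u x) •
        ((Pi.single u 1 - if u ∈ R then 0 else Pi.single x 1 : V → ℝ)) := by
    funext u
    by_cases hu : u ∈ R
    · simp only [if_pos hu, ite_smul, one_smul, zero_smul, sub_zero, Finset.sum_ite_eq',
        Finset.mem_univ, if_true]
      exact if_pos hu
    · ext v
      simp only [groundedLap, hu, Matrix.of_apply, if_false, lap, Finset.sum_apply, Pi.smul_apply,
        Pi.sub_apply, smul_eq_mul, mul_sub, Finset.sum_sub_distrib, Pi.single_apply,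
        mul_ite, mul_one, mul_zero, Finset.sum_ite_eq, Finset.mem_univ, if_true]
      by_cases huv : u = v
      · subst huv
        rw [Finset.filter_ne' Finset.univ u, ← Finset.sum_erase_add _ _ (Finset.mem_univ u)]
        simp
      · simp [huv, Ne.symm huv]
  rw [hrow]
  change Matrix.detRowAlternating.toMultilinearMap _ = _
  rw [MultilinearMap.map_sum]
  simp_rw [MultilinearMap.map_smul_univ]
  rw [parentSum, Finset.sum_filter]
  refine Finset.sum_congr rfl fun f _ => ?_
  change _ • (mapMatrix R f).det = _
  by_cases hfix : ∀ r ∈ R, f r = r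
  · by_cases hf : IsParentMap R f
    · rw [det_mapMatrix_of_isParentMap hf, if_pos hf, smul_eq_mul, mul_one,
        ← Finset.prod_mul_prod_compl R, Finset.prod_eq_one, one_mul]
      · refine Finset.prod_congr rfl fun u hu => ?_
        rw [if_neg (Finset.mem_compl.1 hu)]
      · intro r hr
        rw [if_pos hr, if_pos (hfix r hr)]
    · rw [det_mapMatrix_of_not_isParentMap hfix hf, if_neg hf, smul_zero]
  · rw [if_neg fun hf : IsParentMap R f => hfix hf.1]
    push Not at hfix
    obtain ⟨r, hr, hne⟩ := hfix
    rw [Finset.prod_eq_zero (Finset.mem_univ r), zero_smul]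
    rw [if_pos hr, if_neg hne]

theorem parentSum_insert (w : V → V → ℝ) {R : Finset V} {u v : V} (hu : u ∈ R) (hv : v ∉ R) :
    w v u * parentSum w (insert v R) =
      ∑ f : V → V with IsParentMap R f ∧ f v = u, ∏ x ∈ Rᶜ, w x (f x) := by
  rw [parentSum, Finset.mul_sum]
  have huv : u ≠ v := fun h => hv (h ▸ hu)
  refine Finset.sum_bij' (fun f _ => Function.update f v u) (fun f _ => Function.update f v v)
    ?_ ?_ ?_ ?_ ?_
  · intro f hf
    obtain ⟨hfix, ρ, hρ⟩ := (Finset.mem_filter.1 hf).2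
    refine Finset.mem_filter.2 ⟨Finset.mem_univ _, ⟨?_, fun x => if x ∈ R then 0 else ρ x + 1, ?_⟩,
      by simp⟩
    · intro r hr
      rw [Function.update_of_ne (fun h : r = v => hv (h ▸ hr)),
        hfix r (Finset.mem_insert_of_mem hr)]
    · intro x hx
      by_cases hxv : x = v
      · subst hxv
        simp [hu, hx]
      · have := hρ x (by simp [hx, hxv])
        simp only [Function.update_of_ne hxv, hx, if_false]
        split_ifs <;> omega
  · intro f hf
    obtain ⟨⟨hfix, ρ, hρ⟩, -⟩ := (Finset.mem_filter.1 hf).2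
    refine Finset.mem_filter.2 ⟨Finset.mem_univ _, ⟨?_, ρ, ?_⟩⟩
    · intro r hr
      by_cases hrv : r = v
      · simp [hrv]
      · rw [Function.update_of_ne hrv, hfix r (Finset.mem_of_mem_insert_of_ne hr hrv)]
    · intro x hx
      rw [Finset.mem_insert, not_or] at hx
      rw [Function.update_of_ne hx.1]
      exact hρ x hx.2
  · intro f hf
    have := (Finset.mem_filter.1 hf).2.1 v (Finset.mem_insert_self _ _)
    rw [Function.update_idem, ← this, this, Function.update_eq_self_iff, this]
  · intro f hf
    rw [Function.update_idem, Function.update_eq_self_iff, (Finset.mem_filter.1 hf).2.2]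
  · intro f hf
    have hc : Rᶜ = insert v (insert v R)ᶜ := by
      ext x
      by_cases hx : x = v <;> simp [hx, hv]
    rw [hc, Finset.prod_insert (by simp), Function.update_self]
    congr 1
    refine Finset.prod_congr rfl fun x hx => ?_
    rw [Function.update_of_ne]
    rintro rfl
    simp at hx

theorem groundedLap_insert (w : V → V → ℝ) (R : Finset V) (x : V) :
    groundedLap w (insert x R) = (groundedLap w R).updateRow x (Pi.single x 1) := by
  ext u v
  by_cases hu : u = x
  · subst hu
    simp [groundedLap]
  · simp [groundedLap, hu]

theorem parentSum_insert_eq (w : V → V → ℝ) {R : Finset V} {x : V}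
    (hdet : (groundedLap w R).det ≠ 0) :
    parentSum w (insert x R) = (groundedLap w R).det * (groundedLap w R)⁻¹ x x := by
  rw [← det_groundedLap, groundedLap_insert, ← Matrix.adjugate_apply, Matrix.inv_def,
    Matrix.smul_apply, smul_eq_mul, ← mul_assoc, Ring.mul_inverse_cancel _ hdet.isUnit, one_mul]

theorem parentSum_insert_insert_eq (w : V → V → ℝ) {R : Finset V} {x y : V} (hxy : x ≠ y)
    (hdet : (groundedLap w R).det ≠ 0) :
    parentSum w (insert y (insert x R)) = (groundedLap w R).det *
      ((groundedLap w R)⁻¹ x x * (groundedLap w R)⁻¹ y y -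
        (groundedLap w R)⁻¹ x y * (groundedLap w R)⁻¹ y x) := by
  set M := groundedLap w R with hM
  have hmul' : M⁻¹ * M = 1 := Matrix.nonsing_inv_mul _ hdet.isUnit
  let p : Fin 2 → V := ![x, y]
  let U : Matrix V (Fin 2) ℝ := Matrix.of fun u i => (Pi.single (p i) 1 : V → ℝ) u
  let W : Matrix (Fin 2) V ℝ := Matrix.of fun i v => M⁻¹ (p i) v - (Pi.single (p i) 1 : V → ℝ) v
  have hN : (M.updateRow x (Pi.single x 1)).updateRow y (Pi.single y 1) = (1 + U * W) * M := by
    have hW : W * M = Matrix.of fun i v => (Pi.single (p i) 1 : V → ℝ) v - M (p i) v := by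
      ext i v
      have h1 := congrFun (congrFun hmul' (p i)) v
      rw [Matrix.mul_apply] at h1 ⊢
      simp only [W, Matrix.of_apply, sub_mul, Finset.sum_sub_distrib, h1]
      simp [Pi.single_apply, Matrix.one_apply, eq_comm]
    rw [add_mul, one_mul, Matrix.mul_assoc, hW]
    ext u v
    by_cases huy : u = y
    · subst huy
      simp [U, p, Matrix.mul_apply, hxy.symm]
    · by_cases hux : u = x
      · subst hux
        simp [U, p, Matrix.mul_apply, hxy]
      · simp [U, p, Matrix.mul_apply, hux, huy]
  rw [← det_groundedLap, groundedLap_insert, groundedLap_insert, ← hM, hN, Matrix.det_mul,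
    Matrix.det_one_add_mul_comm, Matrix.det_fin_two, mul_comm]
  congr 1
  have hWU : W * U = Matrix.of fun i j => M⁻¹ (p i) (p j) - (Pi.single (p i) 1 : V → ℝ) (p j) := by
    ext i j
    simp only [U, W, Matrix.mul_apply, Matrix.of_apply, Pi.single_apply, mul_ite, mul_one,
      mul_zero, Finset.sum_ite_eq', Finset.mem_univ, if_true]
  rw [hWU]
  simp [p, hxy, hxy.symm]

theorem sum_isParentMap_mul (w : V → V → ℝ) (hsym : ∀ u v, w u v = w v u)
    (hw : ∀ u v, 0 ≤ w u v) (G : SimpleGraph V) (hG : ∀ u v, G.Adj u v ↔ u ≠ v ∧ 0 < w u v)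
    (R : Finset V) (φ : Finset (Sym2 V) → ℝ) :
    ∑ f : V → V with IsParentMap R f, (∏ u ∈ Rᶜ, w u (f u)) * φ (parentEdges R f) =
      ∑ F ∈ Finset.univ.filter (fun F : Finset (Sym2 V) => (F : Set (Sym2 V)) ⊆ G.edgeSet ∧
          IsRooted R (SimpleGraph.fromEdgeSet (F : Set (Sym2 V)))),
        (∏ e ∈ F, Sym2.lift ⟨w, hsym⟩ e) * φ F := by
  trans ∑ F ∈ Finset.univ.filter (fun F : Finset (Sym2 V) => (∀ e ∈ F, ¬ e.IsDiag) ∧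
      IsRooted R (SimpleGraph.fromEdgeSet (F : Set (Sym2 V)))),
    (∏ e ∈ F, Sym2.lift ⟨w, hsym⟩ e) * φ F
  · refine Finset.sum_nbij (parentEdges R) ?_ ?_ ?_ ?_
    · intro f hf
      have hf' := (Finset.mem_filter.1 hf).2
      refine Finset.mem_filter.2 ⟨Finset.mem_univ _, fun e he => ?_, hf'.isRooted⟩
      obtain ⟨u, hu, rfl⟩ := Finset.mem_image.1 he
      exact fun h => hf'.ne (Finset.mem_compl.1 hu) (Sym2.mk_isDiag_iff.1 h).symm
    · intro f hf g hg hfg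
      exact (Finset.mem_filter.1 hf).2.eq_of_parentEdges_eq (Finset.mem_filter.1 hg).2 hfg
    · intro F hF
      obtain ⟨hdiag, hroot⟩ := (Finset.mem_filter.1 hF).2
      obtain ⟨f, hf, hfF⟩ := exists_parentMap hdiag hroot
      exact ⟨f, Finset.mem_coe.2 (Finset.mem_filter.2 ⟨Finset.mem_univ _, hf⟩), hfF⟩
    · intro f hf
      rw [parentEdges, Finset.prod_image (Finset.mem_filter.1 hf).2.injOn]
      rfl
  · symm
    refine Finset.sum_subset ?_ ?_
    · intro F hF
      obtain ⟨-, hsub, hroot⟩ := Finset.mem_filter.1 hF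
      exact Finset.mem_filter.2 ⟨Finset.mem_univ _,
        fun e he => G.not_isDiag_of_mem_edgeSet (hsub he), hroot⟩
    · intro F hF hF'
      obtain ⟨-, hdiag, hroot⟩ := Finset.mem_filter.1 hF
      have hsub : ¬ (F : Set (Sym2 V)) ⊆ G.edgeSet := fun h =>
        hF' (Finset.mem_filter.2 ⟨Finset.mem_univ _, h, hroot⟩)
      obtain ⟨e, he, heG⟩ := Set.not_subset.1 hsub
      rw [Finset.prod_eq_zero he, zero_mul]
      have hed := hdiag e he
      induction e using Sym2.ind with
      | _ u v =>
        rw [SimpleGraph.mem_edgeSet, hG, not_and] at heG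
        exact le_antisymm (not_lt.1 (heG fun h => hed (Sym2.mk_isDiag_iff.2 h))) (hw u v)

theorem IsParentMap.card_neighbors {R : Finset V} {f : V → V} (hf : IsParentMap R f) (u : V) :
    (Finset.univ.filter fun v => s(u, v) ∈ parentEdges R f).card =
      (if u ∈ R then 0 else 1) + (Rᶜ.filter fun v => f v = u).card := by
  have hsplit : (Finset.univ.filter fun v => s(u, v) ∈ parentEdges R f) =
      (Finset.univ.filter fun v => u ∉ R ∧ f u = v) ∪ Rᶜ.filter fun v => f v = u := by
    ext v
    simp [mem_parentEdges]
  rw [hsplit, Finset.card_union_of_disjoint]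
  · congr 1
    split_ifs with hu <;> simp [hu, Finset.filter_eq]
  · rw [Finset.disjoint_left]
    intro v hv hv'
    obtain ⟨hu, huv⟩ := (Finset.mem_filter.1 hv).2
    obtain ⟨hvR, hvu⟩ := Finset.mem_filter.1 hv'
    exact hf.not_swap hu (Finset.mem_compl.1 hvR) huv hvu

theorem sum_card_neighbors_add_two {s x : V} {F : Finset (Sym2 V)} (hx : x ≠ s)
    (hF : ∀ e ∈ F, ¬ e.IsDiag)
    (h : IsRooted {s, x} (SimpleGraph.fromEdgeSet (F : Set (Sym2 V)))) :
    ∑ u with ¬ (SimpleGraph.fromEdgeSet (F : Set (Sym2 V))).Reachable s u,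
        (Finset.univ.filter fun v => s(u, v) ∈ F).card + 2 =
      2 * (Finset.univ.filter fun u =>
        ¬ (SimpleGraph.fromEdgeSet (F : Set (Sym2 V))).Reachable s u).card := by
  have hsx := ((isRooted_pair_iff hx).1 h).2
  obtain ⟨f, hf, rfl⟩ := exists_parentMap hF h
  set H := SimpleGraph.fromEdgeSet (parentEdges {s, x} f : Set (Sym2 V)) with hH
  set T := Finset.univ.filter fun u => ¬ H.Reachable s u with hT
  have hmem : ∀ u, u ∈ T ↔ ¬ H.Reachable s u := fun u => by simp [hT]
  have hxT : x ∈ T := (hmem x).2 hsx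
  have hsT : s ∉ T := fun h => (hmem s).1 h (SimpleGraph.Reachable.refl s)
  have herase : T.filter (fun u => u ∉ ({s, x} : Finset V)) = T.erase x := by
    ext u
    simp only [Finset.mem_filter, Finset.mem_insert, Finset.mem_singleton, Finset.mem_erase, not_or]
    refine ⟨fun h => ⟨h.2.2, h.1⟩, fun h => ⟨h.2, fun hus => hsT (hus ▸ h.2), h.1⟩⟩
  have h1 : ∑ u ∈ T, (if u ∈ ({s, x} : Finset V) then 0 else 1) = (T.erase x).card := by
    rw [← herase, Finset.card_filter]
    exact Finset.sum_congr rfl fun u _ => by split_ifs <;> rfl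
  have h2 : ∑ u ∈ T, (({s, x} : Finset V)ᶜ.filter fun v => f v = u).card = (T.erase x).card := by
    have hset : T.erase x = ({s, x} : Finset V)ᶜ.filter fun v => f v ∈ T := by
      rw [← herase]
      ext v
      simp only [Finset.mem_filter, Finset.mem_compl, and_comm (a := v ∈ T)]
      refine and_congr_right fun hv => ?_
      have hadj : H.Adj v (f v) := hf.adj_iff.2 (Or.inl ⟨hv, rfl⟩)
      rw [hmem, hmem, not_iff_not]
      exact ⟨fun h => h.trans hadj.reachable, fun h => h.trans hadj.symm.reachable⟩
    have hmaps : Set.MapsTo f (({s, x} : Finset V)ᶜ.filter fun v => f v ∈ T : Finset V) T :=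
      fun v hv => (Finset.mem_filter.1 hv).2
    rw [hset, Finset.card_eq_sum_card_fiberwise hmaps]
    refine Finset.sum_congr rfl fun u hu => ?_
    rw [Finset.filter_filter]
    congr 1
    refine Finset.filter_congr fun v _ => ⟨fun h => ⟨h ▸ hu, h⟩, fun h => h.2⟩
  simp_rw [hf.card_neighbors]
  rw [Finset.sum_add_distrib, h1, h2, Finset.card_erase_of_mem hxT]
  have := Finset.card_pos.2 ⟨x, hxT⟩
  omega

theorem forestSum_one (w : V → V → ℝ) (hsym : ∀ u v, w u v = w v u)
    (hw : ∀ u v, 0 ≤ w u v) (G : SimpleGraph V) (hG : ∀ u v, G.Adj u v ↔ u ≠ v ∧ 0 < w u v)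
    (s : V) : forestSum w hsym G 1 = parentSum w {s} := by
  have h := sum_isParentMap_mul w hsym hw G hG {s} fun _ => 1
  simp only [mul_one, isRooted_singleton_iff] at h
  exact h.symm

theorem forestSum_one_pos (w : V → V → ℝ) (hsym : ∀ u v, w u v = w v u)
    (G : SimpleGraph V) (hG : ∀ u v, G.Adj u v ↔ u ≠ v ∧ 0 < w u v) (hconn : G.Connected) :
    0 < forestSum w hsym G 1 := by
  refine Finset.sum_pos ?_ ?_
  · intro F hF
    refine Finset.prod_pos fun e he => ?_
    have heG := (Finset.mem_filter.1 hF).2.1 he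
    induction e using Sym2.ind with
    | _ u v => exact ((hG u v).1 heG).2
  · obtain ⟨T, hTG, hT⟩ := hconn.exists_isTree_le
    refine ⟨T.edgeFinset, Finset.mem_filter.2 ⟨Finset.mem_univ _, ?_⟩⟩
    rw [SimpleGraph.coe_edgeFinset, SimpleGraph.fromEdgeSet_edgeSet]
    refine ⟨SimpleGraph.edgeSet_mono hTG, hT.isAcyclic, ?_⟩
    have := hT.connected.preconnected.subsingleton_connectedComponent
    have := hT.connected.nonempty
    exact Nat.card_eq_one_iff_unique.2 ⟨inferInstance, ⟨T.connectedComponentMk this.some⟩⟩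

theorem sum_isParentMap_pair_mul (w : V → V → ℝ) (hsym : ∀ u v, w u v = w v u)
    (hw : ∀ u v, 0 ≤ w u v) (G : SimpleGraph V) (hG : ∀ u v, G.Adj u v ↔ u ≠ v ∧ 0 < w u v)
    {s x : V} (hx : x ≠ s) (φ : Finset (Sym2 V) → ℝ) :
    ∑ f : V → V with IsParentMap {s, x} f,
        (∏ u ∈ ({s, x} : Finset V)ᶜ, w u (f u)) * φ (parentEdges {s, x} f) =
      ∑ F ∈ Finset.univ.filter (fun F : Finset (Sym2 V) => (F : Set (Sym2 V)) ⊆ G.edgeSet ∧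
          (SimpleGraph.fromEdgeSet (F : Set (Sym2 V))).IsAcyclic ∧
          Nat.card (SimpleGraph.fromEdgeSet (F : Set (Sym2 V))).ConnectedComponent = 2),
        if ¬ (SimpleGraph.fromEdgeSet (F : Set (Sym2 V))).Reachable s x then
          (∏ e ∈ F, Sym2.lift ⟨w, hsym⟩ e) * φ F else 0 := by
  rw [sum_isParentMap_mul w hsym hw G hG, ← Finset.sum_filter, Finset.filter_filter]
  refine Finset.sum_congr (Finset.filter_congr fun F _ => ?_) fun _ _ => rfl
  rw [isRooted_pair_iff hx, and_assoc, and_assoc, and_assoc]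

theorem parentSum_pair (w : V → V → ℝ) (hsym : ∀ u v, w u v = w v u)
    (hw : ∀ u v, 0 ≤ w u v) (G : SimpleGraph V) (hG : ∀ u v, G.Adj u v ↔ u ≠ v ∧ 0 < w u v)
    {s x : V} (hx : x ≠ s) :
    parentSum w {s, x} =
      ∑ F ∈ Finset.univ.filter (fun F : Finset (Sym2 V) => (F : Set (Sym2 V)) ⊆ G.edgeSet ∧
          (SimpleGraph.fromEdgeSet (F : Set (Sym2 V))).IsAcyclic ∧
          Nat.card (SimpleGraph.fromEdgeSet (F : Set (Sym2 V))).ConnectedComponent = 2),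
        if ¬ (SimpleGraph.fromEdgeSet (F : Set (Sym2 V))).Reachable s x then
          ∏ e ∈ F, Sym2.lift ⟨w, hsym⟩ e else 0 := by
  simpa only [mul_one, parentSum] using sum_isParentMap_pair_mul w hsym hw G hG hx fun _ => 1

theorem sum_mul_parentSum_insert (w : V → V → ℝ) {R : Finset V} {u : V} (hu : u ∈ R) :
    ∑ v ∈ Rᶜ, w v u * parentSum w (insert v R) =
      ∑ f : V → V with IsParentMap R f, (∏ x ∈ Rᶜ, w x (f x)) *
        ((Finset.univ.filter fun v => s(u, v) ∈ parentEdges R f).card : ℝ) := by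
  have h1 : ∀ v ∈ Rᶜ, w v u * parentSum w (insert v R) =
      ∑ f : V → V with IsParentMap R f, if f v = u then ∏ x ∈ Rᶜ, w x (f x) else 0 := by
    intro v hv
    rw [parentSum_insert w hu (Finset.mem_compl.1 hv), ← Finset.sum_filter, Finset.filter_filter]
  rw [Finset.sum_congr rfl h1, Finset.sum_comm]
  refine Finset.sum_congr rfl fun f hf => ?_
  rw [(Finset.mem_filter.1 hf).2.card_neighbors, if_pos hu, zero_add, ← Finset.sum_filter,
    Finset.sum_const, nsmul_eq_mul, mul_comm]

theorem forestSum_two (w : V → V → ℝ) (hsym : ∀ u v, w u v = w v u)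
    (hw : ∀ u v, 0 ≤ w u v) (G : SimpleGraph V) (hG : ∀ u v, G.Adj u v ↔ u ≠ v ∧ 0 < w u v)
    (s : V) :
    forestSum w hsym G 2 = ∑ x with x ≠ s, parentSum w {s, x} -
      1 / 2 * ∑ u with u ≠ s, ∑ v ∈ ({s, u} : Finset V)ᶜ,
        w v u * parentSum w (insert v {s, u}) := by
  have h1 : ∀ x ∈ Finset.univ.filter (fun x => x ≠ s), parentSum w {s, x} = _ := fun x hx =>
    parentSum_pair w hsym hw G hG (Finset.mem_filter.1 hx).2
  have h2 : ∀ u ∈ Finset.univ.filter (fun x => x ≠ s), ∑ v ∈ ({s, u} : Finset V)ᶜ,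
      w v u * parentSum w (insert v {s, u}) = _ := fun u hu =>
    (sum_mul_parentSum_insert w (by simp)).trans
      (sum_isParentMap_pair_mul w hsym hw G hG (Finset.mem_filter.1 hu).2
        fun F => ((Finset.univ.filter fun v => s(u, v) ∈ F).card : ℝ))
  rw [Finset.sum_congr rfl h1, Finset.sum_congr rfl h2, Finset.sum_comm,
    Finset.sum_comm (s := Finset.univ.filter fun x => x ≠ s), Finset.mul_sum,
    ← Finset.sum_sub_distrib, forestSum]
  refine Finset.sum_congr rfl fun F hF => ?_
  obtain ⟨-, hsub, hac, hcard⟩ := Finset.mem_filter.1 hF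
  obtain ⟨c, hc, -⟩ := (Nat.card_eq_two_iff' (SimpleGraph.connectedComponentMk _ s)).1 hcard
  obtain ⟨x, rfl⟩ := c.exists_rep
  have hsx : ¬ (SimpleGraph.fromEdgeSet (F : Set (Sym2 V))).Reachable s x := fun h =>
    hc (SimpleGraph.ConnectedComponent.eq.2 h.symm)
  have hxs : x ≠ s := by
    rintro rfl
    exact hsx (SimpleGraph.Reachable.refl _)
  have hcount := sum_card_neighbors_add_two hxs
    (fun e he => G.not_isDiag_of_mem_edgeSet (hsub he))
    ((isRooted_pair_iff hxs).2 ⟨⟨hac, hcard⟩, hsx⟩)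
  have hfilter : ((Finset.univ.filter fun x => x ≠ s).filter fun u =>
        ¬ (SimpleGraph.fromEdgeSet (F : Set (Sym2 V))).Reachable s u) =
      Finset.univ.filter fun u => ¬ (SimpleGraph.fromEdgeSet (F : Set (Sym2 V))).Reachable s u := by
    rw [Finset.filter_filter]
    refine Finset.filter_congr fun u _ => and_iff_right_of_imp ?_
    rintro h rfl
    exact h (SimpleGraph.Reachable.refl _)
  rw [← Finset.sum_filter, ← Finset.sum_filter, hfilter, ← Finset.mul_sum, Finset.sum_const,
    nsmul_eq_mul]
  have hcount' : ∑ u with ¬ (SimpleGraph.fromEdgeSet (F : Set (Sym2 V))).Reachable s u,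
      ((Finset.univ.filter fun v => s(u, v) ∈ F).card : ℝ) + 2 =
      2 * ((Finset.univ.filter fun u =>
        ¬ (SimpleGraph.fromEdgeSet (F : Set (Sym2 V))).Reachable s u).card : ℝ) := by
    exact_mod_cast hcount
  rw [eq_sub_of_add_eq hcount']
  ring

theorem sum_lap_mul (w : V → V → ℝ) (u : V) (γ : V → ℝ) :
    ∑ v, lap w u v * γ v = ∑ v, w u v * (γ u - γ v) := by
  rw [← Finset.add_sum_erase _ _ (Finset.mem_univ u),
    ← Finset.add_sum_erase Finset.univ (fun v => w u v * (γ u - γ v)) (Finset.mem_univ u)]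
  simp only [lap, Matrix.of_apply, if_true, sub_self, mul_zero, zero_add, Finset.filter_ne',
    Finset.sum_mul, ← Finset.sum_add_distrib]
  refine Finset.sum_congr rfl fun v hv => ?_
  rw [if_neg (Finset.ne_of_mem_erase hv).symm]
  ring

theorem inv_groundedLap_root (w : V → V → ℝ) {s : V} (hdet : (groundedLap w {s}).det ≠ 0)
    {v : V} (hv : v ≠ s) : (groundedLap w {s})⁻¹ s v = 0 := by
  have h := congrFun (congrFun (Matrix.mul_nonsing_inv _ hdet.isUnit) s) v
  rw [Matrix.mul_apply, Matrix.one_apply_ne hv.symm] at h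
  simpa [groundedLap, Pi.single_apply] using h

theorem green_eq_inv (w : V → V → ℝ) {s : V} (hdet : (groundedLap w {s}).det ≠ 0)
    {u v : V} (hu : u ≠ s) (hv : v ≠ s) : green w s u v = (groundedLap w {s})⁻¹ u v := by
  let ι : {x : V // x ≠ s} → V := Subtype.val
  have hmul : (lap w).submatrix ι ι * (groundedLap w {s})⁻¹.submatrix ι ι = 1 := by
    ext ⟨i, hi⟩ ⟨j, hj⟩
    have h := congrFun (congrFun (Matrix.mul_nonsing_inv _ hdet.isUnit) i) j
    rw [Matrix.mul_apply, ← Finset.add_sum_erase _ _ (Finset.mem_univ s),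
      inv_groundedLap_root w hdet hj, mul_zero, zero_add] at h
    have hsum : ∑ x : {x : V // x ≠ s}, groundedLap w {s} i x * (groundedLap w {s})⁻¹ x j =
        ∑ x ∈ Finset.univ.erase s, groundedLap w {s} i x * (groundedLap w {s})⁻¹ x j :=
      (Finset.sum_subtype _ (by simp)
        fun x => groundedLap w {s} i x * (groundedLap w {s})⁻¹ x j).symm
    rw [← hsum] at h
    rw [Matrix.mul_apply]
    simpa [ι, groundedLap, hi, Matrix.one_apply] using h
  rw [green, dif_neg hu, dif_neg hv, Matrix.inv_eq_right_inv hmul]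
  rfl

theorem green_symm (w : V → V → ℝ) (hsym : ∀ u v, w u v = w v u) (s u v : V) :
    green w s u v = green w s v u := by
  by_cases hu : u = s
  · simp [green, hu]
  by_cases hv : v = s
  · simp [green, hv]
  let ι : {x : V // x ≠ s} → V := Subtype.val
  have hS : ((lap w).submatrix ι ι).transpose = (lap w).submatrix ι ι := by
    ext i j
    simp only [ι, lap, Matrix.transpose_apply, Matrix.submatrix_apply, Matrix.of_apply]
    by_cases hij : i.1 = j.1
    · simp [hij]
    · simp [hij, Ne.symm hij, hsym i.1 j.1]
  have hinv := Matrix.transpose_nonsing_inv ((lap w).submatrix ι ι)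
  rw [hS] at hinv
  rw [green, green, dif_neg hu, dif_neg hv, dif_neg hv, dif_neg hu]
  exact congrFun (congrFun hinv ⟨v, hv⟩) ⟨u, hu⟩

theorem sum_mul_green_sub (w : V → V → ℝ) {s : V} (hdet : (groundedLap w {s}).det ≠ 0)
    {u : V} (hu : u ≠ s) : ∑ v, w u v * (green w s u u - green w s v u) = 1 := by
  have h := congrFun (congrFun (Matrix.mul_nonsing_inv _ hdet.isUnit) u) u
  rw [Matrix.mul_apply, Matrix.one_apply_eq] at h
  rw [← sum_lap_mul w u fun v => green w s v u, ← h]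
  refine Finset.sum_congr rfl fun v _ => ?_
  congr 1
  · simp [groundedLap, hu]
  · by_cases hv : v = s
    · subst hv
      rw [inv_groundedLap_root w hdet hu, green, dif_pos rfl]
    · exact green_eq_inv w hdet hv hu

end RootedForest

open RootedForest

theorem sum_sq_pker_eq {V : Type*} [Fintype V] (w γ : V → V → ℝ) (hsym : ∀ u v, w u v = w v u)
    (hγ : ∀ u v, γ u v = γ v u) (hone : ∀ u, γ u u * ∑ v, w u v * (γ u u - γ v u) = γ u u) :
    1 / 2 * ∑ u, ∑ v, w u v * (((γ u u - γ u v) - (γ v v - γ v u)) ^ 2 +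
        (γ u u - γ u v) * (γ v v - γ v u)) =
      ∑ u, γ u u - 1 / 2 * ∑ u, ∑ v, w v u * (γ u u * γ v v - γ u v * γ v u) := by
  have h1 : ∑ u, ∑ v, w u v * (γ u u * (γ u u - γ v u)) = ∑ u, γ u u := by
    refine Finset.sum_congr rfl fun u _ => ?_
    refine Eq.trans ?_ (hone u)
    rw [Finset.mul_sum]
    exact Finset.sum_congr rfl fun v _ => by ring
  have h2 : ∑ u, ∑ v, w u v * (γ v v * (γ v v - γ v u)) = ∑ u, γ u u := by
    rw [← h1, Finset.sum_comm]
    refine Finset.sum_congr rfl fun u _ => Finset.sum_congr rfl fun v _ => ?_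
    rw [hsym v u, hγ u v]
  have h3 : ∑ u, ∑ v, w u v * (((γ u u - γ u v) - (γ v v - γ v u)) ^ 2 +
        (γ u u - γ u v) * (γ v v - γ v u)) +
      ∑ u, ∑ v, w v u * (γ u u * γ v v - γ u v * γ v u) =
      ∑ u, ∑ v, w u v * (γ u u * (γ u u - γ v u)) +
      ∑ u, ∑ v, w u v * (γ v v * (γ v v - γ v u)) := by
    simp only [← Finset.sum_add_distrib]
    refine Finset.sum_congr rfl fun u _ => Finset.sum_congr rfl fun v _ => ?_
    rw [hsym v u, hγ u v]
    ring
  linarith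

/-- `F₂(G) = F₁(G) · Σ_{{u,v} ∈ E} w(u,v) [(A^{(s)}_{u,v} − A^{(s)}_{v,u})² +
A^{(s)}_{u,v} A^{(s)}_{v,u}]`, where the sum over unordered edges is written as half
of the sum over ordered pairs (the summand is symmetric in `u` and `v`). -/
theorem stmt_3 {V : Type*} [Fintype V] [DecidableEq V]
    (hV : 1 < Fintype.card V)
    (w : V → V → ℝ) (hsym : ∀ u v, w u v = w v u)
    (hw : ∀ u v, 0 ≤ w u v) (hw0 : ∀ v, w v v = 0)
    (G : SimpleGraph V) (hG : ∀ u v, G.Adj u v ↔ u ≠ v ∧ 0 < w u v)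
    (hconn : G.Connected) (s : V) :
    forestSum w hsym G 2
      = forestSum w hsym G 1 *
        ((1/2) * ∑ u : V, ∑ v : V,
          (if G.Adj u v
            then w u v * ((pker w s u v - pker w s v u) ^ 2 + pker w s u v * pker w s v u)
            else 0)) := by
  have hF1 := forestSum_one w hsym hw G hG s
  have hdet : (groundedLap w {s}).det ≠ 0 := by
    rw [det_groundedLap, ← hF1]
    exact (forestSum_one_pos w hsym G hG hconn).ne'
  have hgreen_left : ∀ v, green w s s v = 0 := fun v => by simp [green]
  have hgreen_right : ∀ v, green w s v s = 0 := fun v => by simp [green]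
  have hone : ∀ u, green w s u u * ∑ v, w u v * (green w s u u - green w s v u) =
      green w s u u := by
    intro u
    by_cases hu : u = s
    · rw [hu, hgreen_left, zero_mul]
    · rw [sum_mul_green_sub w hdet hu, mul_one]
  have hsummand : ∀ u v, (if G.Adj u v
      then w u v * ((pker w s u v - pker w s v u) ^ 2 + pker w s u v * pker w s v u) else 0) =
      w u v * (((green w s u u - green w s u v) - (green w s v v - green w s v u)) ^ 2 +
        (green w s u u - green w s u v) * (green w s v v - green w s v u)) := by
    intro u v
    split_ifs with h
    · rfl
    · have hzero : w u v = 0 := by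
        by_cases huv : u = v
        · rw [huv, hw0]
        · rw [hG, not_and] at h
          exact le_antisymm (not_lt.1 (h huv)) (hw u v)
      rw [hzero, zero_mul]
  simp_rw [hsummand]
  rw [sum_sq_pker_eq w (green w s) hsym (green_symm w hsym s) hone, forestSum_two w hsym hw G hG s,
    hF1, ← det_groundedLap, mul_sub, mul_left_comm]
  congr 1
  · rw [Finset.mul_sum, Finset.sum_filter]
    refine Finset.sum_congr rfl fun x _ => ?_
    split_ifs with hx
    · rw [Finset.pair_comm, parentSum_insert_eq w hdet, green_eq_inv w hdet hx hx]
    · rw [not_not.1 hx, hgreen_left, mul_zero]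
  · congr 1
    rw [Finset.mul_sum, Finset.sum_filter]
    refine Finset.sum_congr rfl fun u _ => ?_
    split_ifs with hu
    · rw [Finset.mul_sum]
      refine Finset.sum_subset_zero_on_sdiff (Finset.subset_univ _) ?_ ?_
      · intro v hv
        have hv' : v = s ∨ v = u := by simpa [or_iff_not_imp_left] using hv
        rcases hv' with rfl | rfl
        · simp [hgreen_left, hgreen_right]
        · rw [hw0, zero_mul, mul_zero]
      · intro v hv
        have hv' : ¬ (v = s ∨ v = u) := by simpa using hv
        obtain ⟨hvs, hvu⟩ := not_or.1 hv'
        rw [Finset.pair_comm, parentSum_insert_insert_eq w (Ne.symm hvu) hdet,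
          green_eq_inv w hdet hu hu, green_eq_inv w hdet hvs hvs, green_eq_inv w hdet hu hvs,
          green_eq_inv w hdet hvs hu]
        ring
    · simp [not_not.1 hu, hgreen_left]
end

section
/- Let G = (V,E) be a finite connected simple graph with at least two vertices. Then 4·|E|·N₂ ≥ (|V|−1)²·N₁, where N₁ is the number of spanning trees of G and N₂ is the number of two-component spanning forests of G (subsets F ⊆ E such that (V,F) is acyclic with exactly two connected components). -/
open scoped Classical

open Matrix Polynomial in
/-- The **Cauchy–Binet formula**, with each product of maximal minors written as a principal
minor. -/
theorem Matrix.det_mul_eq_sum_minors {m n R : Type*} [Fintype m] [Fintype n] [CommRing R]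
    (A : Matrix m n R) (B : Matrix n m R) :
    (A * B).det = ∑ s ∈ Finset.univ.powersetCard (Fintype.card m),
      ((B * A).submatrix (Subtype.val : s → n) (Subtype.val : s → n)).det := by
  have key : (1 + (X : R[X]) • (A * B).map C).det = (1 + (X : R[X]) • (B * A).map C).det := by
    rw [Matrix.map_mul, Matrix.map_mul, ← Matrix.smul_mul, det_one_add_mul_comm, Matrix.mul_smul]
  rw [← coeff_det_one_add_X_smul_eq_sum_minors, ← key, coeff_det_one_add_X_smul_eq_sum_minors,
    ← Finset.card_univ, Finset.powersetCard_self, Finset.sum_singleton]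
  exact (det_submatrix_equiv_self (Equiv.subtypeUnivEquiv Finset.mem_univ) _).symm

namespace SpanningForest

open Matrix Finset

variable {V : Type*} [Fintype V]

/-- The signed incidence vector of an edge; it vanishes on the diagonal of `Sym2 V`. -/
noncomputable def incVec (R : Type*) [CommRing R] (e : Sym2 V) : V → R :=
  Pi.single e.out.1 1 - Pi.single e.out.2 1

/-- Signed incidence matrix of the complete graph on `V` together with a pendant edge (a "root")
at each vertex. -/
noncomputable def rootedInc (R : Type*) [CommRing R] (V : Type*) : Matrix V (Sym2 V ⊕ V) R :=
  Matrix.of fun v j =>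
    Sum.elim (fun e => incVec R e v) (fun s => Pi.single (M := fun _ => R) s 1 v) j

omit [Fintype V] in
@[simp] theorem rootedInc_inl (R : Type*) [CommRing R] (v : V) (e : Sym2 V) :
    rootedInc R V v (Sum.inl e) = incVec R e v := rfl

omit [Fintype V] in
@[simp] theorem rootedInc_inr (R : Type*) [CommRing R] (v s : V) :
    rootedInc R V v (Sum.inr s) = Pi.single (M := fun _ => R) s 1 v := rfl

/-- Every vertex is joined by edges of `F` to a vertex of `S`. -/
def Hits (F : Finset (Sym2 V)) (S : Finset V) : Prop :=
  ∀ v, ∃ s ∈ S, (SimpleGraph.fromEdgeSet (F : Set (Sym2 V))).Reachable v s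

omit [Fintype V] in
theorem out_eq (e : Sym2 V) : s(e.out.1, e.out.2) = e := Quot.out_eq e

omit [Fintype V] in
theorem single_sub_single_mem {R : Type*} [CommRing R] {F : Finset (Sym2 V)}
    {W : Submodule R (V → R)} (hW : ∀ e ∈ F, incVec R e ∈ W) {a b : V}
    (h : (SimpleGraph.fromEdgeSet (F : Set (Sym2 V))).Reachable a b) :
    (Pi.single a 1 - Pi.single b 1 : V → R) ∈ W := by
  obtain ⟨p⟩ := h
  induction p with
  | nil => simp
  | @cons u v w huv p ih =>
    have h1 : (Pi.single u 1 - Pi.single v 1 : V → R) ∈ W := by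
      have he := hW s(u, v) (by simpa using huv.1)
      have ho := out_eq s(u, v)
      rw [Sym2.eq_iff] at ho
      unfold incVec at he
      rcases ho with ⟨h1, h2⟩ | ⟨h1, h2⟩
      · rwa [h1, h2] at he
      · rw [h1, h2] at he
        simpa using W.neg_mem he
    simpa using W.add_mem h1 ih

theorem isUnit_det_of_hits {R : Type*} [CommRing R] {J : Finset (Sym2 V ⊕ V)} (f : V ≃ J)
    (h : Hits J.toLeft J.toRight) :
    IsUnit ((rootedInc R V).submatrix id (Subtype.val ∘ f)).det := by
  set C := (rootedInc R V).submatrix id (Subtype.val ∘ f) with hC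
  set W := LinearMap.range C.mulVecLin with hWdef
  have hcol : ∀ j (hj : j ∈ J), (fun v => rootedInc R V v j) ∈ W := by
    intro j hj
    refine ⟨Pi.single (f.symm ⟨j, hj⟩) 1, ?_⟩
    ext v
    simp [hC]
  have hsurj : ∀ v, ∃ d, C *ᵥ d = Pi.single v 1 := by
    intro v
    obtain ⟨s, hs, hr⟩ := h v
    have h1 := single_sub_single_mem (R := R) (W := W)
      (fun e he => hcol (Sum.inl e) (by simpa using he)) hr
    have h2 : (Pi.single s 1 : V → R) ∈ W := 
      hcol (Sum.inr s) (Finset.mem_toRight.1 hs)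
    have h3 := W.add_mem h1 h2
    rw [sub_add_cancel] at h3
    exact h3
  choose d hd using hsurj
  have hCD : C * (Matrix.of d)ᵀ = 1 := by
    ext i j
    have := congrFun (hd j) i
    rw [Matrix.one_apply]
    simpa [Matrix.mul_apply, Matrix.mulVec, dotProduct, Pi.single_apply] using this
  exact isUnit_iff_exists_inv.2 ⟨_, by rw [← det_mul, hCD, det_one]⟩

theorem det_eq_zero_of_not_hits {R : Type*} [CommRing R] [IsDomain R] {J : Finset (Sym2 V ⊕ V)}
    (f : V ≃ J) (h : ¬ Hits J.toLeft J.toRight) :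
    ((rootedInc R V).submatrix id (Subtype.val ∘ f)).det = 0 := by
  simp only [Hits, not_forall, not_exists, not_and] at h
  obtain ⟨v, hv⟩ := h
  set H := SimpleGraph.fromEdgeSet (J.toLeft : Set (Sym2 V)) with hH
  refine exists_vecMul_eq_zero_iff.1 ⟨fun w => if H.Reachable v w then 1 else 0, ?_, ?_⟩
  · intro h0
    simpa using congrFun h0 v
  · ext j
    obtain ⟨j', hj⟩ : ∃ j', j' = f j := ⟨_, rfl⟩
    rcases j' with ⟨e | s, hj'⟩
    · have : H.Reachable v e.out.1 ↔ H.Reachable v e.out.2 := by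
        by_cases hd : e.out.1 = e.out.2
        · rw [hd]
        · have hadj : H.Adj e.out.1 e.out.2 := by
            rw [hH, SimpleGraph.fromEdgeSet_adj, out_eq]
            exact ⟨by simpa using hj', hd⟩
          exact ⟨fun h => h.trans hadj.reachable, fun h => h.trans hadj.symm.reachable⟩
      simp [vecMul, dotProduct, ← hj, incVec, mul_sub, Pi.single_apply, this]
    · have := hv s (by simpa using hj')
      simp [vecMul, dotProduct, ← hj, Pi.single_apply, this]

theorem det_sq_eq {J : Finset (Sym2 V ⊕ V)} (f : V ≃ J) :
    ((rootedInc ℤ V).submatrix id (Subtype.val ∘ f)).det ^ 2 =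
      if Hits J.toLeft J.toRight then 1 else 0 := by
  split_ifs with h
  · exact Int.isUnit_sq (isUnit_det_of_hits f h)
  · rw [det_eq_zero_of_not_hits f h]; rfl

/-- Edge sets `F ⊆ E` of size `|V| - |S|` all of whose components meet `S`. -/
noncomputable def rootedForests (E : Finset (Sym2 V)) (S : Finset V) : Finset (Finset (Sym2 V)) :=
  E.powerset.filter fun F => F.card + S.card = Fintype.card V ∧ Hits F S

/-- The Laplacian of the edge set `E` with roots at `Z`. -/
noncomputable def lap (R : Type*) [CommRing R] (E : Finset (Sym2 V)) (Z : Finset V) :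
    Matrix V V R :=
  ∑ e ∈ E, vecMulVec (incVec R e) (incVec R e) + ∑ s ∈ Z, vecMulVec (Pi.single s 1) (Pi.single s 1)

theorem lap_eq_mul (R : Type*) [CommRing R] (E : Finset (Sym2 V)) (Z : Finset V) :
    lap R E Z = (rootedInc R V * diagonal fun j => if j ∈ E.disjSum Z then (1 : R) else 0) *
      (rootedInc R V)ᵀ := by
  ext u v
  rw [Matrix.mul_apply, Fintype.sum_sum_type]
  simp [lap, Matrix.sum_apply, vecMulVec_apply, Matrix.mul_diagonal]

/-- The **all-principal-minors matrix-tree theorem**. -/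
theorem det_lap_int (E : Finset (Sym2 V)) (Z : Finset V) :
    (lap ℤ E Z).det = ∑ S ∈ Z.powerset, ((rootedForests E S).card : ℤ) := by
  rw [lap_eq_mul, det_mul_eq_sum_minors]
  have hterm : ∀ J ∈ (univ : Finset (Sym2 V ⊕ V)).powersetCard (Fintype.card V),
      (((rootedInc ℤ V)ᵀ * (rootedInc ℤ V * diagonal fun j =>
        if j ∈ E.disjSum Z then (1 : ℤ) else 0)).submatrix
          (Subtype.val : J → _) (Subtype.val : J → _)).det =
      if J ⊆ E.disjSum Z ∧ Hits J.toLeft J.toRight then 1 else 0 := by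
    intro J hJ
    have hc : Fintype.card V = Fintype.card J := by
      simpa using (mem_powersetCard.1 hJ).2.symm
    let f : V ≃ J := Fintype.equivOfCardEq hc
    rw [← Matrix.mul_assoc]
    have : (((rootedInc ℤ V)ᵀ * rootedInc ℤ V * diagonal fun j =>
        if j ∈ E.disjSum Z then (1 : ℤ) else 0).submatrix
          (Subtype.val : J → _) (Subtype.val : J → _)).submatrix f f =
        (((rootedInc ℤ V).submatrix id (Subtype.val ∘ f))ᵀ *
          (rootedInc ℤ V).submatrix id (Subtype.val ∘ f)) *
            diagonal fun v => if (f v : Sym2 V ⊕ V) ∈ E.disjSum Z then (1 : ℤ) else 0 := by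
      ext i j
      rw [submatrix_apply, submatrix_apply, Matrix.mul_diagonal, Matrix.mul_diagonal,
        Matrix.mul_apply, Matrix.mul_apply]
      rfl
    rw [← det_submatrix_equiv_self f, this, det_mul, det_mul, det_transpose, ← sq, det_sq_eq,
      det_diagonal, Finset.prod_ite_zero]
    have hiff : (∀ i ∈ (univ : Finset V), (f i : Sym2 V ⊕ V) ∈ E.disjSum Z) ↔
        J ⊆ E.disjSum Z := by
      refine ⟨fun h j hj => ?_, fun h i _ => h (f i).2⟩
      simpa using h (f.symm ⟨j, hj⟩) (mem_univ _)
    simp only [hiff]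
    split_ifs <;> simp_all
  rw [show _ = _ from sum_congr rfl fun J hJ => by convert hterm J hJ,
    ← sum_filter, sum_const, nsmul_one, ← Nat.cast_sum, ← card_sigma]
  congr 1
  refine card_bij' (fun J _ => ⟨J.toRight, J.toLeft⟩) (fun p _ => p.2.disjSum p.1) ?_ ?_ ?_ ?_
  · intro J hJ
    simp only [mem_filter, mem_powersetCard, mem_sigma, mem_powerset, rootedForests] at hJ ⊢
    obtain ⟨⟨-, hc⟩, hs, hh⟩ := hJ
    refine ⟨fun s hs' => ?_, fun e he => ?_, ?_, hh⟩
    · simpa using hs (mem_toRight.1 hs')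
    · simpa using hs (mem_toLeft.1 he)
    · rw [← hc, card_toLeft_add_card_toRight]
  · rintro ⟨S, F⟩ hp
    simp only [mem_filter, mem_powersetCard, mem_sigma, mem_powerset, rootedForests] at hp ⊢
    obtain ⟨hS, hF, hc, hh⟩ := hp
    refine ⟨⟨subset_univ _, ?_⟩, disjSum_mono hF hS, ?_⟩
    · rw [card_disjSum, hc]
    · simpa using hh
  · exact fun J _ => toLeft_disjSum_toRight
  · simp

theorem det_lap (E : Finset (Sym2 V)) (Z : Finset V) :
    (lap ℝ E Z).det = ∑ S ∈ Z.powerset, ((rootedForests E S).card : ℝ) := by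
  have hmap : lap ℝ E Z = (lap ℤ E Z).map (Int.castRingHom ℝ) := by
    ext u v
    simp [lap, Matrix.sum_apply, vecMulVec_apply, incVec, Pi.single_apply]
  rw [hmap, ← RingHom.mapMatrix_apply, ← RingHom.map_det, det_lap_int]
  simp

/-! ### Graph-theoretic description of rooted forests -/

omit [Fintype V] in
theorem natCard_edgeSet {F : Finset (Sym2 V)} (hF : ∀ e ∈ F, ¬ e.IsDiag) :
    Nat.card (SimpleGraph.fromEdgeSet (F : Set (Sym2 V))).edgeSet = F.card := by
  have : (F : Set (Sym2 V)) \ Sym2.diagSet = F := by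
    ext e
    simpa using fun he => hF e he
  rw [SimpleGraph.edgeSet_fromEdgeSet, this]
  simp

omit [Fintype V] in
theorem hits_singleton [Nonempty V] {F : Finset (Sym2 V)} (r : V) :
    Hits F {r} ↔ (SimpleGraph.fromEdgeSet (F : Set (Sym2 V))).Connected := by
  constructor
  · intro h
    simp only [Hits, mem_singleton, exists_eq_left] at h
    exact ⟨fun a b => (h a).trans (h b).symm⟩
  · intro h v
    exact ⟨r, by simp, h v r⟩

theorem mem_rootedForests_singleton [Nonempty V] {E F : Finset (Sym2 V)}
    (hE : ∀ e ∈ E, ¬ e.IsDiag) (r : V) :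
    F ∈ rootedForests E {r} ↔ F ⊆ E ∧
      (SimpleGraph.fromEdgeSet (F : Set (Sym2 V))).Connected ∧
      (SimpleGraph.fromEdgeSet (F : Set (Sym2 V))).IsAcyclic := by
  simp only [rootedForests, mem_filter, mem_powerset, hits_singleton, card_singleton]
  refine and_congr_right fun hF => ?_
  have := SimpleGraph.isTree_iff_connected_and_card
    (G := SimpleGraph.fromEdgeSet (F : Set (Sym2 V)))
  rw [natCard_edgeSet fun e he => hE e (hF he), Nat.card_eq_fintype_card,
    SimpleGraph.isTree_iff] at this
  tauto

omit [Fintype V] in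
theorem hits_pair [Nonempty V] {F : Finset (Sym2 V)} {r u : V} (hur : r ≠ u) :
    Hits F {r, u} ↔
      (SimpleGraph.fromEdgeSet ((insert s(r, u) F : Finset (Sym2 V)) : Set (Sym2 V))).Connected := by
  set H := SimpleGraph.fromEdgeSet (F : Set (Sym2 V)) with hH
  set K := SimpleGraph.fromEdgeSet ((insert s(r, u) F : Finset (Sym2 V)) : Set (Sym2 V)) with hK
  have hle : H ≤ K := SimpleGraph.fromEdgeSet_mono (by simp)
  have hru : K.Adj r u := by simp [hK, hur]
  simp only [Hits, mem_insert, mem_singleton, exists_eq_or_imp, exists_eq_left]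
  constructor
  · intro h
    have hr : ∀ v, K.Reachable v r := fun v => (h v).elim (fun h => h.mono hle)
      fun h => (h.mono hle).trans hru.symm.reachable
    exact ⟨fun a b => (hr a).trans (hr b).symm⟩
  · have key : ∀ a b (p : K.Walk a b), (H.Reachable b r ∨ H.Reachable b u) →
        (H.Reachable a r ∨ H.Reachable a u) := by
      intro a b p hb
      induction p with
      | nil => exact hb
      | @cons a b c hab p ih =>
        rw [hK, SimpleGraph.fromEdgeSet_adj, coe_insert, Set.mem_insert_iff, Sym2.eq_iff] at hab
        rcases hab with ⟨(⟨rfl, rfl⟩ | ⟨rfl, rfl⟩) | hF, hne⟩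
        · exact Or.inl (SimpleGraph.Reachable.refl _)
        · exact Or.inr (SimpleGraph.Reachable.refl _)
        · have hH' : H.Reachable a b :=
            SimpleGraph.Adj.reachable ((SimpleGraph.fromEdgeSet_adj _).2 ⟨hF, hne⟩)
          exact (ih hb).imp hH'.trans hH'.trans
    intro h v
    obtain ⟨p⟩ := h v r
    exact key v r p (Or.inl (SimpleGraph.Reachable.refl _))

theorem mem_rootedForests_pair [Nonempty V] {E F : Finset (Sym2 V)}
    (hE : ∀ e ∈ E, ¬ e.IsDiag) {r u : V} (hur : r ≠ u) :
    F ∈ rootedForests E {r, u} ↔ (F ⊆ E ∧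
      (SimpleGraph.fromEdgeSet (F : Set (Sym2 V))).IsAcyclic ∧
      Nat.card (SimpleGraph.fromEdgeSet (F : Set (Sym2 V))).ConnectedComponent = 2) ∧
      ¬ (SimpleGraph.fromEdgeSet (F : Set (Sym2 V))).Reachable r u := by
  simp only [rootedForests, mem_filter, mem_powerset, card_pair hur, and_assoc]
  refine and_congr_right fun hF => ?_
  set H := SimpleGraph.fromEdgeSet (F : Set (Sym2 V)) with hH
  have hFd : ∀ e ∈ F, ¬ e.IsDiag := fun e he => hE e (hF he)
  by_cases hreach : H.Reachable r u
  · simp only [hreach, not_true, and_false, iff_false, not_and]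
    intro hc hh
    have hconn : H.Connected := by
      rw [← hits_singleton r]
      intro v
      obtain ⟨s, hs, hvs⟩ := hh v
      refine ⟨r, by simp, ?_⟩
      rcases mem_insert.1 hs with rfl | hs
      · exact hvs
      · rw [mem_singleton.1 hs] at hvs
        exact hvs.trans hreach.symm
    have := hconn.card_vert_le_card_edgeSet_add_one
    rw [natCard_edgeSet hFd, Nat.card_eq_fintype_card] at this
    omega
  · simp only [hreach, not_false_iff, and_true]
    have hnot : s(r, u) ∉ F := fun h => hreach (SimpleGraph.Adj.reachable (by simp [hH, h, hur]))
    have hins : ∀ e ∈ insert s(r, u) F, ¬ e.IsDiag := by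
      intro e he
      rcases mem_insert.1 he with rfl | he
      · simpa using hur
      · exact hFd e he
    have htree := SimpleGraph.isTree_iff_connected_and_card
      (G := SimpleGraph.fromEdgeSet ((insert s(r, u) F : Finset (Sym2 V)) : Set (Sym2 V)))
    rw [natCard_edgeSet hins, Nat.card_eq_fintype_card, card_insert_of_notMem hnot,
      SimpleGraph.isTree_iff, ← hits_pair hur] at htree
    have hac : (SimpleGraph.fromEdgeSet
        ((insert s(r, u) F : Finset (Sym2 V)) : Set (Sym2 V))).IsAcyclic ↔ H.IsAcyclic := by
      rw [← SimpleGraph.isAcyclic_add_edge_iff_of_not_reachable r u hreach]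
      have : H ⊔ SimpleGraph.edge r u = SimpleGraph.fromEdgeSet
          ((insert s(r, u) F : Finset (Sym2 V)) : Set (Sym2 V)) := by
        rw [hH, SimpleGraph.edge, ← SimpleGraph.fromEdgeSet_union]
        congr 1
        simp
      rw [this]
    have hcomp : Hits F {r, u} ↔ Nat.card H.ConnectedComponent = 2 := by
      have hne : H.connectedComponentMk r ≠ H.connectedComponentMk u := by
        simpa [SimpleGraph.ConnectedComponent.eq] using hreach
      simp only [Hits, mem_insert, mem_singleton, exists_eq_or_imp, exists_eq_left]
      constructor
      · intro h
        rw [Nat.card_eq_two_iff]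
        refine ⟨_, _, hne, ?_⟩
        ext c
        induction c using SimpleGraph.ConnectedComponent.ind with
        | h v => simpa [SimpleGraph.ConnectedComponent.eq] using h v
      · intro h v
        by_contra! hv
        rw [Nat.card_eq_fintype_card] at h
        have : Finset.card {H.connectedComponentMk r, H.connectedComponentMk u,
            H.connectedComponentMk v} = 3 := by
          rw [card_eq_three]
          refine ⟨_, _, _, hne, ?_, ?_, rfl⟩
          · simpa [SimpleGraph.ConnectedComponent.eq] using fun h => hv.1 h.symm
          · simpa [SimpleGraph.ConnectedComponent.eq] using fun h => hv.2 h.symm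
        have := card_le_univ ({H.connectedComponentMk r, H.connectedComponentMk u,
            H.connectedComponentMk v} : Finset _)
        omega
    rw [← hcomp]
    rw [hac] at htree
    tauto

theorem rootedForests_empty [Nonempty V] (E : Finset (Sym2 V)) : rootedForests E ∅ = ∅ := by
  rw [Finset.eq_empty_iff_forall_notMem]
  intro F hF
  obtain ⟨s, hs, -⟩ := (mem_filter.1 hF).2.2 (Classical.arbitrary V)
  simp at hs

/-- If `F` has two components, the one avoiding `r` has at most one vertex more than edges. -/
theorem card_not_reachable_le_card_edges_add_one {F : Finset (Sym2 V)}
    (hF : Nat.card (SimpleGraph.fromEdgeSet (F : Set (Sym2 V))).ConnectedComponent = 2) (r : V) :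
    (univ.filter fun v => ¬ (SimpleGraph.fromEdgeSet (F : Set (Sym2 V))).Reachable r v).card ≤
      (F.filter fun e =>
        ¬ (SimpleGraph.fromEdgeSet (F : Set (Sym2 V))).Reachable r e.out.1).card + 1 := by
  set H := SimpleGraph.fromEdgeSet (F : Set (Sym2 V)) with hH
  obtain ⟨c, hc, huniq⟩ := (Nat.card_eq_two_iff' (H.connectedComponentMk r)).1 hF
  have hmem : ∀ v, ¬ H.Reachable r v ↔ v ∈ c.supp := by
    intro v
    rw [SimpleGraph.ConnectedComponent.mem_supp_iff]
    constructor
    · intro h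
      refine huniq _ fun h' => h ?_
      exact (SimpleGraph.ConnectedComponent.eq.1 h').symm
    · rintro rfl h
      exact hc (SimpleGraph.ConnectedComponent.eq.2 h.symm)
  have h1 := c.connected_toSimpleGraph.card_vert_le_card_edgeSet_add_one
  have h2 : Nat.card c = (univ.filter fun v => ¬ H.Reachable r v).card := by
    rw [Nat.card_eq_fintype_card]
    exact Fintype.card_of_subtype _ fun v => by
      rw [mem_filter]
      exact (and_iff_right (mem_univ v)).trans (hmem v)
  have h3 : Nat.card c.toSimpleGraph.edgeSet ≤
      (F.filter fun e => ¬ H.Reachable r e.out.1).card := by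
    rw [← Nat.card_eq_finsetCard]
    refine Nat.card_le_card_of_injective (fun e => ⟨Sym2.map Subtype.val e.1, ?_⟩) ?_
    · obtain ⟨e, he⟩ := e
      induction e using Sym2.ind with
      | h a b =>
        have hab : H.Adj a b := he
        rw [mem_filter, Sym2.map_mk, hmem]
        refine ⟨((SimpleGraph.fromEdgeSet_adj _).1 hab).1, ?_⟩
        have ho := out_eq s(a.1, b.1)
        rw [Sym2.eq_iff] at ho
        rcases ho with ⟨h, -⟩ | ⟨h, -⟩
        · rw [h]; exact a.2
        · rw [h]; exact b.2
    · intro e e' h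
      exact Subtype.ext (Sym2.map.injective Subtype.val_injective (Subtype.mk.inj h))
  rw [h2] at h1
  exact h1.trans (Nat.add_le_add_right h3 1)

/-! ### Effective resistances -/

theorem det_add_vecMulVec_add_vecMulVec {A : Matrix V V ℝ} (hA : IsUnit A.det)
    (a b c d : V → ℝ) :
    (A + vecMulVec a b + vecMulVec c d).det = A.det *
      ((1 + b ⬝ᵥ A⁻¹ *ᵥ a) * (1 + d ⬝ᵥ A⁻¹ *ᵥ c) - (b ⬝ᵥ A⁻¹ *ᵥ c) * (d ⬝ᵥ A⁻¹ *ᵥ a)) := by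
  have h : vecMulVec a b + vecMulVec c d = (Matrix.of ![a, c])ᵀ * Matrix.of ![b, d] := by
    ext i j
    simp [Matrix.mul_apply, Fin.sum_univ_two, vecMulVec_apply]
  rw [add_assoc, h, det_add_mul _ _ hA, Matrix.mul_assoc, det_fin_two]
  congr 1
  have hentry : ∀ (p q : Fin 2 → V → ℝ) (i j : Fin 2),
      (Matrix.of p * (A⁻¹ * (Matrix.of q)ᵀ)) i j = p i ⬝ᵥ A⁻¹ *ᵥ q j := fun _ _ _ _ => rfl
  simp [hentry, Matrix.add_apply, -cons_mul]

theorem det_add_vecMulVec {A : Matrix V V ℝ} (hA : IsUnit A.det) (a b : V → ℝ) :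
    (A + vecMulVec a b).det = A.det * (1 + b ⬝ᵥ A⁻¹ *ᵥ a) := by
  simpa using det_add_vecMulVec_add_vecMulVec hA a b 0 0

omit [Fintype V] in
theorem lap_transpose (E : Finset (Sym2 V)) (Z : Finset V) : (lap ℝ E Z)ᵀ = lap ℝ E Z := by
  simp [lap, transpose_sum, transpose_vecMulVec]

omit [Fintype V] in
theorem lap_pair (E : Finset (Sym2 V)) {r u : V} (hur : r ≠ u) :
    lap ℝ E {r, u} = lap ℝ E {r} + vecMulVec (Pi.single u 1) (Pi.single u 1) := by
  simp [lap, sum_pair hur, add_assoc]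

omit [Fintype V] in
theorem lap_erase {E : Finset (Sym2 V)} {e : Sym2 V} (he : e ∈ E) (Z : Finset V) :
    lap ℝ (E.erase e) Z = lap ℝ E Z + vecMulVec (-incVec ℝ e) (incVec ℝ e) := by
  rw [lap, lap, ← add_sum_erase E _ he, neg_vecMulVec]
  abel

theorem lap_mulVec_one (E : Finset (Sym2 V)) (r : V) :
    lap ℝ E {r} *ᵥ 1 = Pi.single r 1 := by
  ext v
  simp [lap, Matrix.add_mulVec, Matrix.sum_mulVec, vecMulVec_mulVec, incVec, sub_dotProduct]

section Green

variable {E : Finset (Sym2 V)} {r : V}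

theorem green_apply_comm (u v : V) : (lap ℝ E {r})⁻¹ u v = (lap ℝ E {r})⁻¹ v u := by
  conv_lhs => rw [← lap_transpose, ← transpose_nonsing_inv, transpose_apply]

theorem green_apply_root (h : IsUnit (lap ℝ E {r}).det) (v : V) : (lap ℝ E {r})⁻¹ v r = 1 := by
  have h1 : (lap ℝ E {r})⁻¹ *ᵥ (lap ℝ E {r} *ᵥ 1) = 1 := by
    rw [mulVec_mulVec, nonsing_inv_mul _ h, one_mulVec]
  rw [lap_mulVec_one] at h1
  simpa using congrFun h1 v

/-- Effective resistance between the ends of `e`. -/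
noncomputable def resistance (E : Finset (Sym2 V)) (r : V) (e : Sym2 V) : ℝ :=
  (lap ℝ E {r})⁻¹ e.out.1 e.out.1 + (lap ℝ E {r})⁻¹ e.out.2 e.out.2
    - 2 * (lap ℝ E {r})⁻¹ e.out.1 e.out.2

theorem incVec_green_incVec (e : Sym2 V) :
    incVec ℝ e ⬝ᵥ (lap ℝ E {r})⁻¹ *ᵥ incVec ℝ e = resistance E r e := by
  have := green_apply_comm (E := E) (r := r) e.out.2 e.out.1
  simp only [incVec, mulVec_sub, sub_dotProduct, dotProduct_sub, single_one_dotProduct,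
    mulVec_single_one, col_apply, resistance, this]
  ring

theorem sum_eq_green (h : IsUnit (lap ℝ E {r}).det) (f : V → ℝ) :
    ∑ v, f v = f r + ∑ e ∈ E,
      (f e.out.1 * ((lap ℝ E {r})⁻¹ e.out.1 e.out.1 - (lap ℝ E {r})⁻¹ e.out.1 e.out.2) +
       f e.out.2 * ((lap ℝ E {r})⁻¹ e.out.2 e.out.2 - (lap ℝ E {r})⁻¹ e.out.1 e.out.2)) := by
  set G := (lap ℝ E {r})⁻¹ with hG
  have h1 : ∑ v, f v = (diagonal f * (lap ℝ E {r} * G)).trace := by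
    rw [mul_nonsing_inv _ h, Matrix.mul_one, trace_diagonal]
  have hterm : ∀ a b : V → ℝ,
      (diagonal f * (vecMulVec a b * G)).trace = ∑ v, f v * a v * (b ᵥ* G) v := by
    intro a b
    simp [trace, vecMulVec_mul, vecMulVec_apply, mul_assoc]
  rw [h1, lap, Matrix.add_mul, Matrix.mul_add, trace_add, Matrix.sum_mul, Matrix.mul_sum, trace_sum,
    sum_singleton, add_comm]
  congr 1
  · rw [hterm]
    simp [Pi.single_apply, hG, green_apply_root h]
  · refine sum_congr rfl fun e _ => ?_
    have hc : G e.out.2 e.out.1 = G e.out.1 e.out.2 := green_apply_comm _ _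
    rw [hterm]
    simp only [incVec, Pi.sub_apply, mul_sub, sub_mul, sum_sub_distrib, Pi.single_apply, mul_ite,
      mul_one, mul_zero, ite_mul, zero_mul, sum_ite_eq', mem_univ, if_true, sub_vecMul,
      single_one_vecMul, Matrix.row_apply, hc]
    ring

/-- **Foster's theorem**. -/
theorem sum_resistance (h : IsUnit (lap ℝ E {r}).det) :
    ∑ e ∈ E, resistance E r e = Fintype.card V - 1 := by
  have := sum_eq_green h fun _ => 1
  simp only [sum_const, card_univ, nsmul_eq_mul, mul_one, one_mul] at this
  rw [this, add_sub_cancel_left]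
  exact sum_congr rfl fun e _ => by rw [resistance]; ring

/-- With `x v` the effective resistance between `v` and `r`, the two sides differ by
`3 / 4 * ∑ e, (x e.out.1 - x e.out.2) ^ 2`. -/
theorem sum_sq_resistance_le (h : IsUnit (lap ℝ E {r}).det) :
    (∑ e ∈ E, resistance E r e ^ 2) / 4 ≤
      ∑ v, ((lap ℝ E {r})⁻¹ v v - 1) - ∑ e ∈ E,
        (((lap ℝ E {r})⁻¹ e.out.1 e.out.1 - 1) * resistance E r e -
          ((lap ℝ E {r})⁻¹ e.out.1 e.out.1 - (lap ℝ E {r})⁻¹ e.out.1 e.out.2) ^ 2) := by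
  rw [sum_eq_green h, green_apply_root h, sub_self, zero_add, ← sum_sub_distrib, sum_div]
  refine sum_le_sum fun e _ => ?_
  rw [resistance]
  nlinarith [sq_nonneg ((lap ℝ E {r})⁻¹ e.out.1 e.out.1 - (lap ℝ E {r})⁻¹ e.out.2 e.out.2)]

end Green

/-! ### Counting forests -/

/-- The spanning forests with edges in `E` and exactly two components. -/
noncomputable def twoForests (E : Finset (Sym2 V)) : Finset (Finset (Sym2 V)) :=
  univ.filter fun F => F ⊆ E ∧ (SimpleGraph.fromEdgeSet (F : Set (Sym2 V))).IsAcyclic ∧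
    Nat.card (SimpleGraph.fromEdgeSet (F : Set (Sym2 V))).ConnectedComponent = 2

section Count

variable [Nonempty V] {E : Finset (Sym2 V)}

theorem card_rootedForests_singleton (hE : ∀ e ∈ E, ¬ e.IsDiag) (r u : V) :
    (rootedForests E {r}).card = (rootedForests E {u}).card := by
  congr 1
  ext F
  rw [mem_rootedForests_singleton hE, mem_rootedForests_singleton hE]

theorem det_lap_singleton (E : Finset (Sym2 V)) (r : V) :
    (lap ℝ E {r}).det = (rootedForests E {r}).card := by
  rw [det_lap, ← insert_empty_eq, sum_powerset_insert (by simp)]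
  simp [rootedForests_empty]

theorem rootedForests_pair (hE : ∀ e ∈ E, ¬ e.IsDiag) {r u : V} (hur : r ≠ u) :
    rootedForests E {r, u} = (twoForests E).filter fun F : Finset (Sym2 V) =>
      ¬ (SimpleGraph.fromEdgeSet (F : Set (Sym2 V))).Reachable r u := by
  ext F
  rw [mem_rootedForests_pair hE hur, mem_filter, twoForests, mem_filter]
  simp

theorem card_separating (hE : ∀ e ∈ E, ¬ e.IsDiag) {r u : V} (hur : r ≠ u) :
    (((twoForests E).filter fun F : Finset (Sym2 V) =>
      ¬ (SimpleGraph.fromEdgeSet (F : Set (Sym2 V))).Reachable r u).card : ℝ) =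
      (lap ℝ E {r, u}).det - 2 * (lap ℝ E {r}).det := by
  rw [← rootedForests_pair hE hur, det_lap_singleton, det_lap,
    sum_powerset_insert (by simpa using hur), ← insert_empty_eq u, sum_powerset_insert (by simp),
    sum_powerset_insert (by simp)]
  simp [rootedForests_empty, card_rootedForests_singleton hE u r]
  ring

/-- Two-component forests separating `u` from `r`, counted by an effective resistance. -/
theorem card_separating_eq_green (hE : ∀ e ∈ E, ¬ e.IsDiag) {r : V}
    (h : IsUnit (lap ℝ E {r}).det) (u : V) :
    (((twoForests E).filter fun F : Finset (Sym2 V) =>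
      ¬ (SimpleGraph.fromEdgeSet (F : Set (Sym2 V))).Reachable r u).card : ℝ) =
      (lap ℝ E {r}).det * ((lap ℝ E {r})⁻¹ u u - 1) := by
  rcases eq_or_ne r u with rfl | hur
  · simp [green_apply_root h]
  · rw [card_separating hE hur, lap_pair E hur, det_add_vecMulVec h]
    simp only [single_one_dotProduct, mulVec_single_one, col_apply]
    ring

theorem card_mem_separating_eq_green (hE : ∀ e ∈ E, ¬ e.IsDiag) {r : V}
    (h : IsUnit (lap ℝ E {r}).det) {e : Sym2 V} (he : e ∈ E) :
    (((twoForests E).filter fun F : Finset (Sym2 V) => e ∈ F ∧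
      ¬ (SimpleGraph.fromEdgeSet (F : Set (Sym2 V))).Reachable r e.out.1).card : ℝ) =
      (lap ℝ E {r}).det * (((lap ℝ E {r})⁻¹ e.out.1 e.out.1 - 1) * resistance E r e -
          ((lap ℝ E {r})⁻¹ e.out.1 e.out.1 - (lap ℝ E {r})⁻¹ e.out.1 e.out.2) ^ 2) := by
  rcases eq_or_ne r e.out.1 with hr | hur
  · have h1 := green_apply_root h e.out.1
    have h2 := green_apply_root h e.out.2
    rw [green_apply_comm] at h2
    rw [← hr] at *
    simp [h1, h2]
  · have hsplit : (twoForests E).filter (fun F : Finset (Sym2 V) =>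
        ¬ (SimpleGraph.fromEdgeSet (F : Set (Sym2 V))).Reachable r e.out.1) =
        ((twoForests E).filter fun F : Finset (Sym2 V) => e ∈ F ∧
          ¬ (SimpleGraph.fromEdgeSet (F : Set (Sym2 V))).Reachable r e.out.1).disjUnion
        ((twoForests (E.erase e)).filter fun F : Finset (Sym2 V) =>
          ¬ (SimpleGraph.fromEdgeSet (F : Set (Sym2 V))).Reachable r e.out.1)
        (by
          rw [Finset.disjoint_left]
          intro F hF hF'
          simp only [twoForests, mem_filter, subset_erase] at hF hF'
          tauto) := by
      ext F
      simp only [twoForests, mem_filter, mem_disjUnion, subset_erase]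
      tauto
    have hcard := congrArg (fun s => (s.card : ℝ)) hsplit
    simp only [card_disjUnion, Nat.cast_add] at hcard
    rw [card_separating_eq_green hE h, card_separating (fun f hf => hE f (mem_of_mem_erase hf)) hur,
      lap_erase he, lap_erase he, lap_pair E hur, add_right_comm,
      det_add_vecMulVec_add_vecMulVec h, det_add_vecMulVec h] at hcard
    have hR := incVec_green_incVec (E := E) (r := r) e
    have h1 : (Pi.single e.out.1 1 : V → ℝ) ⬝ᵥ (lap ℝ E {r})⁻¹ *ᵥ incVec ℝ e =
      (lap ℝ E {r})⁻¹ e.out.1 e.out.1 - (lap ℝ E {r})⁻¹ e.out.1 e.out.2 := by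
      simp [incVec, mulVec_sub]
    have h2 : incVec ℝ e ⬝ᵥ (lap ℝ E {r})⁻¹ *ᵥ Pi.single e.out.1 1 =
      (lap ℝ E {r})⁻¹ e.out.1 e.out.1 - (lap ℝ E {r})⁻¹ e.out.1 e.out.2 := by
      rw [green_apply_comm e.out.1 e.out.2]
      simp [incVec, sub_dotProduct]
    simp only [mulVec_neg, dotProduct_neg, hR, h1, h2] at hcard
    simp only [single_one_dotProduct, mulVec_single_one, col_apply] at hcard
    linear_combination -hcard

theorem sum_sq_resistance_mul_le (hE : ∀ e ∈ E, ¬ e.IsDiag) {r : V}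
    (h : IsUnit (lap ℝ E {r}).det) :
    (lap ℝ E {r}).det * ((∑ e ∈ E, resistance E r e ^ 2) / 4) ≤ (twoForests E).card := by
  have hcount : ∑ v, ((twoForests E).filter fun F : Finset (Sym2 V) =>
      ¬ (SimpleGraph.fromEdgeSet (F : Set (Sym2 V))).Reachable r v).card ≤
      ∑ e ∈ E, ((twoForests E).filter fun F : Finset (Sym2 V) => e ∈ F ∧
        ¬ (SimpleGraph.fromEdgeSet (F : Set (Sym2 V))).Reachable r e.out.1).card +
      (twoForests E).card := by
    simp only [card_filter]
    rw [sum_comm, sum_comm (s := E), card_eq_sum_ones, ← sum_add_distrib]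
    refine sum_le_sum fun F hF => ?_
    simp only [twoForests, mem_filter] at hF
    have := card_not_reachable_le_card_edges_add_one hF.2.2.2 r
    rw [← card_filter, ← card_filter]
    refine this.trans (Nat.add_le_add_right (card_le_card fun e he => ?_) 1)
    simp only [mem_filter] at he ⊢
    exact ⟨hF.2.1 he.1, he⟩
  have hcount' : (∑ v, (lap ℝ E {r}).det * ((lap ℝ E {r})⁻¹ v v - 1)) ≤
      ∑ e ∈ E, (lap ℝ E {r}).det * (((lap ℝ E {r})⁻¹ e.out.1 e.out.1 - 1) * resistance E r e -
        ((lap ℝ E {r})⁻¹ e.out.1 e.out.1 - (lap ℝ E {r})⁻¹ e.out.1 e.out.2) ^ 2) +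
      (twoForests E).card := by
    rw [← sum_congr rfl fun v _ => card_separating_eq_green hE h v,
      ← sum_congr rfl fun e he => card_mem_separating_eq_green hE h he]
    exact_mod_cast hcount
  rw [← mul_sum, ← mul_sum] at hcount'
  have hdet : 0 ≤ (lap ℝ E {r}).det := by
    rw [det_lap_singleton]
    exact Nat.cast_nonneg _
  have := mul_le_mul_of_nonneg_left (sum_sq_resistance_le h) hdet
  rw [mul_sub] at this
  linarith

theorem card_sq_mul_card_rootedForests_le (hE : ∀ e ∈ E, ¬ e.IsDiag) (r : V) :
    (Fintype.card V - 1) ^ 2 * (rootedForests E {r}).card ≤ 4 * E.card * (twoForests E).card := by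
  rcases Nat.eq_zero_or_pos (rootedForests E {r}).card with h0 | hpos
  · simp [h0]
  have hpos' : 0 < (lap ℝ E {r}).det := by
    rw [det_lap_singleton]
    exact_mod_cast hpos
  have hu : IsUnit (lap ℝ E {r}).det := hpos'.ne'.isUnit
  have h1 := sum_sq_resistance_mul_le hE hu
  have h2 := sq_sum_le_card_mul_sum_sq (s := E) (f := resistance E r)
  rw [sum_resistance hu] at h2
  have h3 := mul_le_mul_of_nonneg_left h2 hpos'.le
  have h4 := mul_le_mul_of_nonneg_left h1 (Nat.cast_nonneg (α := ℝ) E.card)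
  rw [← Nat.cast_le (α := ℝ)]
  push_cast [Nat.cast_sub (Fintype.card_pos (α := V))]
  rw [← det_lap_singleton]
  linarith

end Count

end SpanningForest


/-- For a finite connected simple graph `G = (V,E)` with at least two vertices,
`4·|E|·N₂ ≥ (|V|−1)²·N₁`, where `N₁` is the number of spanning trees and `N₂` the
number of two-component spanning forests (acyclic edge subsets whose spanning
subgraph has exactly two connected components). -/
theorem stmt_5 {V : Type*} [Fintype V] [DecidableEq V] (G : SimpleGraph V)
    (hV : 2 ≤ Fintype.card V) (hconn : G.Connected) :
    (Fintype.card V - 1) ^ 2 *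
      (Finset.univ.filter (fun T : Finset (Sym2 V) =>
        (T : Set (Sym2 V)) ⊆ G.edgeSet ∧
        (SimpleGraph.fromEdgeSet (T : Set (Sym2 V))).Connected ∧
        (SimpleGraph.fromEdgeSet (T : Set (Sym2 V))).IsAcyclic)).card
    ≤ 4 * G.edgeFinset.card *
      (Finset.univ.filter (fun F : Finset (Sym2 V) =>
        (F : Set (Sym2 V)) ⊆ G.edgeSet ∧
        (SimpleGraph.fromEdgeSet (F : Set (Sym2 V))).IsAcyclic ∧
        Nat.card (SimpleGraph.fromEdgeSet (F : Set (Sym2 V))).ConnectedComponent = 2)).card := by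
  have : Nonempty V := hconn.nonempty
  have hE : ∀ e ∈ G.edgeFinset, ¬ e.IsDiag := fun e he =>
    G.not_isDiag_of_mem_edgeSet (SimpleGraph.mem_edgeFinset.1 he)
  have hsub : ∀ T : Finset (Sym2 V), T ⊆ G.edgeFinset ↔ (T : Set (Sym2 V)) ⊆ G.edgeSet := by
    intro T
    rw [← Finset.coe_subset, SimpleGraph.coe_edgeFinset]
  convert SpanningForest.card_sq_mul_card_rootedForests_le hE (Classical.arbitrary V) using 3
  · ext T
    rw [SpanningForest.mem_rootedForests_singleton hE, hsub]
    simp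
  · simp only [SpanningForest.twoForests, hsub]
end
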